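/- arXiv:2206.07908 — 6 statements merged into one kernel-verified Lean document; each statement's English description precedes it below -/
import Mathlib

section
/- Let F_0 ⊆ F_1 ⊆ ... ⊆ F_n be a filtration on a probability space and let X_1, ..., X_n be real random variables such that each X_t is F_t-measurable, E[X_t | F_{t-1}] = 0 almost surely, and |X_t| ≤ b almost surely for some b > 0. Let V_n = Σ_{t=1}^n E[X_t² | F_{t-1}]. Then for every δ ∈ (0,1), with probability at least 1 − δ, Σ_{t=1}^n X_t ≤ sqrt(4 V_n log(n/δ) + 5 b² log²(n/δ)). -/
open MeasureTheory Finset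

lemma Real.exp_le_one_add_add_three_quarters_sq {x : ℝ} (hx : |x| ≤ 1) :
    Real.exp x ≤ 1 + x + 3 / 4 * x ^ 2 := by
  have h := Real.exp_bound hx (n := 3) (by norm_num)
  simp only [Finset.sum_range_succ, Finset.sum_range_zero] at h
  norm_num [Nat.factorial] at h
  have h1 := (abs_le.1 h).2
  have h2 : |x| ^ 3 ≤ x ^ 2 := by
    rw [← sq_abs x]
    exact pow_le_pow_of_le_one (abs_nonneg x) hx (by norm_num)
  nlinarith [sq_nonneg x]

lemma exists_mul_sqrt_sub_ge {v L : ℝ} (hv : 1 ≤ v) (hL : 3 / 5 ≤ L) :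
    ∃ r : ℝ, 0 ≤ r ∧ r ≤ 1 ∧
      L ≤ r * Real.sqrt (4 * (v - 1) * L + 5 * L ^ 2) - 3 / 4 * r ^ 2 * v := by
  have hq : 0 ≤ 4 * (v - 1) * L + 5 * L ^ 2 := by
    have : 0 ≤ (v - 1) * L := mul_nonneg (by linarith) (by linarith)
    nlinarith [sq_nonneg L]
  set s := Real.sqrt (4 * (v - 1) * L + 5 * L ^ 2) with hs
  have hs0 : 0 ≤ s := Real.sqrt_nonneg _
  have hs2 : s ^ 2 = 4 * (v - 1) * L + 5 * L ^ 2 := Real.sq_sqrt hq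
  have hv0 : 0 < v := by linarith
  by_cases h : s ≤ 3 / 2 * v
  · refine ⟨s / (3 / 2 * v), by positivity, (div_le_one (by positivity)).2 h, ?_⟩
    have e : s / (3 / 2 * v) * s - 3 / 4 * (s / (3 / 2 * v)) ^ 2 * v = s ^ 2 / (3 * v) := by
      field_simp
      ring
    rw [e, le_div_iff₀ (by positivity), hs2]
    nlinarith
  · push Not at h
    refine ⟨1, by norm_num, le_rfl, ?_⟩
    have h1 : (3 / 2 * v) ^ 2 ≤ s ^ 2 := pow_le_pow_left₀ (by positivity) h.le 2
    have h2 : L + 3 / 4 * v ≤ s := by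
      apply abs_le_of_sq_le_sq' _ hs0 |>.2
      nlinarith [mul_nonneg (sub_nonneg.2 hv) (sub_nonneg.2 hL)]
    linarith

section

variable {Ω : Type*} {m' m : MeasurableSpace Ω} {μ : Measure Ω}

lemma ae_abs_sq_le {X : Ω → ℝ} {b : ℝ} (hb : ∀ᵐ ω ∂μ, |X ω| ≤ b) :
    ∀ᵐ ω ∂μ, |X ω ^ 2| ≤ b ^ 2 := by
  filter_upwards [hb] with ω h
  rw [abs_pow]
  exact pow_le_pow_left₀ (abs_nonneg _) h 2

lemma condExp_sq_nonneg (X : Ω → ℝ) :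
    ∀ᵐ ω ∂μ, 0 ≤ (μ[fun ω' => X ω' ^ 2 | m']) ω :=
  condExp_nonneg (ae_of_all _ fun ω => sq_nonneg (X ω))

variable [IsProbabilityMeasure μ]

lemma integral_mul_condExp_of_bounded (hm : m' ≤ m) {M Y : Ω → ℝ} {C : ℝ}
    (hM : StronglyMeasurable[m'] M) (hMC : ∀ᵐ ω ∂μ, |M ω| ≤ C) (hY : Integrable Y μ) :
    ∫ ω, M ω * Y ω ∂μ = ∫ ω, M ω * (μ[Y | m']) ω ∂μ := by
  have hMY : Integrable (M * Y) μ := hY.bdd_mul (hM.mono hm).aestronglyMeasurable hMC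
  calc ∫ ω, M ω * Y ω ∂μ = ∫ ω, (μ[M * Y | m']) ω ∂μ := (integral_condExp hm).symm
    _ = _ := integral_congr_ae (condExp_mul_of_stronglyMeasurable_left hM hMY hY)

lemma integrable_of_ae_abs_le {f : Ω → ℝ} {C : ℝ} (hf : StronglyMeasurable[m] f)
    (hC : ∀ᵐ ω ∂μ, |f ω| ≤ C) : Integrable f μ :=
  Integrable.of_bound hf.aestronglyMeasurable C hC

lemma condExp_sq_le (hm : m' ≤ m) {X : Ω → ℝ} {b : ℝ} (hX : StronglyMeasurable[m] X)
    (hb : ∀ᵐ ω ∂μ, |X ω| ≤ b) :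
    ∀ᵐ ω ∂μ, (μ[fun ω' => X ω' ^ 2 | m']) ω ≤ b ^ 2 := by
  have hi : Integrable (fun ω => X ω ^ 2) μ :=
    integrable_of_ae_abs_le (hX.pow 2) (ae_abs_sq_le hb)
  have h := condExp_mono (m := m') hi
    (integrable_const (b ^ 2)) ((ae_abs_sq_le hb).mono fun ω h => (le_abs_self _).trans h)
  filter_upwards [h] with ω h
  simpa [condExp_const hm] using h

lemma integral_mul_exp_le (hm : m' ≤ m) {X M : Ω → ℝ} {b r C : ℝ}
    (hX : StronglyMeasurable[m] X) (hcond : μ[X | m'] =ᵐ[μ] 0)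
    (hb : ∀ᵐ ω ∂μ, |X ω| ≤ b) (hr : |r| * b ≤ 1)
    (hM : StronglyMeasurable[m'] M) (hM0 : ∀ ω, 0 ≤ M ω) (hMC : ∀ᵐ ω ∂μ, M ω ≤ C) :
    ∫ ω, M ω * Real.exp (r * X ω - 3 / 4 * r ^ 2 * (μ[fun ω' => X ω' ^ 2 | m']) ω) ∂μ
      ≤ ∫ ω, M ω ∂μ := by
  set V := μ[fun ω' => X ω' ^ 2 | m'] with hV
  have hVm : StronglyMeasurable[m'] V := stronglyMeasurable_condExp
  have hV0 : ∀ᵐ ω ∂μ, 0 ≤ V ω := condExp_sq_nonneg X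
  have hXi := integrable_of_ae_abs_le hX hb
  have hX2i : Integrable (fun ω => X ω ^ 2) μ := integrable_of_ae_abs_le (hX.pow 2) (ae_abs_sq_le hb)
  set N : Ω → ℝ := fun ω => M ω * Real.exp (-(3 / 4 * r ^ 2 * V ω)) with hN
  have hNm : StronglyMeasurable[m'] N :=
    hM.mul (Real.continuous_exp.comp_stronglyMeasurable (hVm.const_mul _).neg)
  have hNM : ∀ᵐ ω ∂μ, N ω ≤ M ω := by
    filter_upwards [hV0] with ω h
    exact mul_le_of_le_one_right (hM0 ω) (Real.exp_le_one_iff.2 (by simp only [neg_nonpos]; positivity))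
  have hN0 : ∀ ω, 0 ≤ N ω := fun ω => mul_nonneg (hM0 ω) (Real.exp_pos _).le
  have hNC : ∀ᵐ ω ∂μ, |N ω| ≤ C := by
    filter_upwards [hNM, hMC] with ω h1 h2
    rw [abs_of_nonneg (hN0 ω)]
    exact h1.trans h2
  set Y : Ω → ℝ := (fun _ => 1) + (r • X + (3 / 4 * r ^ 2) • fun ω => X ω ^ 2) with hYdef
  have hYi : Integrable Y μ :=
    (integrable_const 1).add ((hXi.smul r).add (hX2i.smul (3 / 4 * r ^ 2)))
  have hYc : μ[Y | m'] =ᵐ[μ] fun ω => 1 + 3 / 4 * r ^ 2 * V ω := by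
    have h1 := condExp_add (m := m') (integrable_const (μ := μ) (1 : ℝ))
      ((hXi.smul r).add (hX2i.smul (3 / 4 * r ^ 2)))
    have h2 := condExp_add (m := m') (hXi.smul r) (hX2i.smul (3 / 4 * r ^ 2))
    have h3 := condExp_smul (μ := μ) r X m'
    have h4 := condExp_smul (μ := μ) (3 / 4 * r ^ 2) (fun ω => X ω ^ 2) m'
    filter_upwards [h1, h2, h3, h4, hcond] with ω h1 h2 h3 h4 h5
    rw [h1, Pi.add_apply, h2, Pi.add_apply, h3, h4, condExp_const hm]
    simp [h5, hV]
  have hMi : Integrable M μ := integrable_of_ae_abs_le (hM.mono hm)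
    (hMC.mono fun ω h => (abs_of_nonneg (hM0 ω)).trans_le h)
  calc ∫ ω, M ω * Real.exp (r * X ω - 3 / 4 * r ^ 2 * V ω) ∂μ
      ≤ ∫ ω, N ω * Y ω ∂μ := by
        refine integral_mono_of_nonneg
          (ae_of_all _ fun ω => mul_nonneg (hM0 ω) (Real.exp_pos _).le)
          (hYi.bdd_mul (hNm.mono hm).aestronglyMeasurable hNC) ?_
        filter_upwards [hb] with ω h
        have hx : |r * X ω| ≤ 1 := by
          rw [abs_mul]
          exact (mul_le_mul_of_nonneg_left h (abs_nonneg r)).trans hr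
        have h1 := Real.exp_le_one_add_add_three_quarters_sq hx
        have h2 : N ω * Real.exp (r * X ω) ≤ N ω * Y ω := by
          refine mul_le_mul_of_nonneg_left (h1.trans_eq ?_) (hN0 ω)
          simp [hYdef]
          ring
        refine le_trans (le_of_eq ?_) h2
        simp only [hN]
        rw [mul_assoc (M ω), ← Real.exp_add, neg_add_eq_sub]
    _ = ∫ ω, N ω * (μ[Y | m']) ω ∂μ := integral_mul_condExp_of_bounded hm hNm hNC hYi
    _ ≤ ∫ ω, M ω ∂μ := by
        refine integral_mono_ae (integrable_condExp.bdd_mul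
          (hNm.mono hm).aestronglyMeasurable hNC) hMi ?_
        filter_upwards [hYc] with ω h
        simp only [h, hN]
        rw [mul_assoc]
        refine mul_le_of_le_one_right (hM0 ω) ?_
        have := Real.add_one_le_exp (3 / 4 * r ^ 2 * V ω)
        calc _ ≤ Real.exp (-(3 / 4 * r ^ 2 * V ω)) * Real.exp (3 / 4 * r ^ 2 * V ω) := by
              gcongr
              linarith
          _ = 1 := by rw [← Real.exp_add]; simp

/-- The exponential process of a bounded martingale difference sequence is bounded and has
expectation at most one. -/
lemma exp_martingale_bound (n : ℕ) (F : Filtration ℕ m) (X : ℕ → Ω → ℝ) (b r : ℝ)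
    (hr : |r| * b ≤ 1)
    (hmeas : ∀ t ∈ Finset.Icc 1 n, StronglyMeasurable[F t] (X t))
    (hcond : ∀ t ∈ Finset.Icc 1 n, μ[X t | F (t - 1)] =ᵐ[μ] 0)
    (hbdd : ∀ t ∈ Finset.Icc 1 n, ∀ᵐ ω ∂μ, |X t ω| ≤ b) :
    StronglyMeasurable[F n] (fun ω => Real.exp (r * ∑ t ∈ Finset.Icc 1 n, X t ω -
        3 / 4 * r ^ 2 * ∑ t ∈ Finset.Icc 1 n, (μ[fun ω' => X t ω' ^ 2 | F (t - 1)]) ω)) ∧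
    (∀ᵐ ω ∂μ, Real.exp (r * ∑ t ∈ Finset.Icc 1 n, X t ω -
        3 / 4 * r ^ 2 * ∑ t ∈ Finset.Icc 1 n, (μ[fun ω' => X t ω' ^ 2 | F (t - 1)]) ω)
        ≤ Real.exp n) ∧
    ∫ ω, Real.exp (r * ∑ t ∈ Finset.Icc 1 n, X t ω -
        3 / 4 * r ^ 2 * ∑ t ∈ Finset.Icc 1 n, (μ[fun ω' => X t ω' ^ 2 | F (t - 1)]) ω) ∂μ
        ≤ 1 := by
  induction n with
  | zero => simpa using stronglyMeasurable_const
  | succ k ih =>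
    have hsub : ∀ t ∈ Finset.Icc 1 k, t ∈ Finset.Icc 1 (k + 1) := fun t ht => by
      simp only [Finset.mem_Icc] at ht ⊢
      omega
    have hk : k + 1 ∈ Finset.Icc 1 (k + 1) := by simp
    obtain ⟨h1, h2, h3⟩ := ih (fun t ht => hmeas t (hsub t ht)) (fun t ht => hcond t (hsub t ht))
      (fun t ht => hbdd t (hsub t ht))
    have hX := hmeas _ hk
    have hc := hcond _ hk
    have hb := hbdd _ hk
    rw [Nat.add_sub_cancel] at hc
    set M : Ω → ℝ := fun ω => Real.exp (r * ∑ t ∈ Finset.Icc 1 k, X t ω -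
        3 / 4 * r ^ 2 * ∑ t ∈ Finset.Icc 1 k, (μ[fun ω' => X t ω' ^ 2 | F (t - 1)]) ω) with hM
    have e : (fun ω => Real.exp (r * ∑ t ∈ Finset.Icc 1 (k + 1), X t ω -
        3 / 4 * r ^ 2 * ∑ t ∈ Finset.Icc 1 (k + 1), (μ[fun ω' => X t ω' ^ 2 | F (t - 1)]) ω))
        = fun ω => M ω * Real.exp (r * X (k + 1) ω -
          3 / 4 * r ^ 2 * (μ[fun ω' => X (k + 1) ω' ^ 2 | F k]) ω) := by
      funext ω
      rw [hM, ← Real.exp_add, Finset.sum_Icc_succ_top (by omega),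
        Finset.sum_Icc_succ_top (by omega), Nat.add_sub_cancel]
      ring_nf
    have e' := fun ω => congrFun e ω
    simp only [e']
    refine ⟨?_, ?_, ?_⟩
    · refine (h1.mono (F.mono k.le_succ)).mul (Real.continuous_exp.comp_stronglyMeasurable ?_)
      exact (hX.const_mul r).sub
        ((stronglyMeasurable_condExp.mono (F.mono k.le_succ)).const_mul _)
    · filter_upwards [h2, hb, condExp_sq_nonneg (μ := μ) (m' := F k) (X (k + 1))] with ω h2 hb hV
      have hx : r * X (k + 1) ω ≤ 1 := by
        refine (le_abs_self _).trans ?_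
        rw [abs_mul]
        exact (mul_le_mul_of_nonneg_left hb (abs_nonneg r)).trans hr
      push_cast
      rw [Real.exp_add]
      have : 0 ≤ 3 / 4 * r ^ 2 * (μ[fun ω' => X (k + 1) ω' ^ 2 | F k]) ω := by positivity
      exact mul_le_mul h2 (Real.exp_le_exp.2 (by linarith)) (Real.exp_pos _).le (Real.exp_pos _).le
    · exact (integral_mul_exp_le (F.le k) (hX.mono (F.le _)) hc hb hr h1
        (fun ω => (Real.exp_pos _).le) h2).trans h3

/-- Freedman's inequality on an event where the predictable quadratic variation is bounded. -/
lemma measure_sum_ge_and_variation_le (n : ℕ) (F : Filtration ℕ m) (X : ℕ → Ω → ℝ) {b : ℝ}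
    (hb : 0 < b)
    (hmeas : ∀ t ∈ Finset.Icc 1 n, StronglyMeasurable[F t] (X t))
    (hcond : ∀ t ∈ Finset.Icc 1 n, μ[X t | F (t - 1)] =ᵐ[μ] 0)
    (hbdd : ∀ t ∈ Finset.Icc 1 n, ∀ᵐ ω ∂μ, |X t ω| ≤ b)
    {v L : ℝ} (hv : 1 ≤ v) (hL : 3 / 5 ≤ L) :
    μ {ω | b * Real.sqrt (4 * (v - 1) * L + 5 * L ^ 2) ≤ ∑ t ∈ Finset.Icc 1 n, X t ω ∧
      ∑ t ∈ Finset.Icc 1 n, (μ[fun ω' => X t ω' ^ 2 | F (t - 1)]) ω ≤ v * b ^ 2}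
      ≤ ENNReal.ofReal (Real.exp (-L)) := by
  obtain ⟨r, hr0, hr1, hr⟩ := exists_mul_sqrt_sub_ge hv hL
  obtain ⟨h1, h2, h3⟩ := exp_martingale_bound (μ := μ) n F X b (r / b)
    (by rw [abs_of_nonneg (by positivity), div_mul_cancel₀ _ hb.ne']; exact hr1) hmeas hcond hbdd
  have hi := integrable_of_ae_abs_le (h1.mono (F.le n))
    (h2.mono fun ω h => (abs_of_pos (Real.exp_pos _)).trans_le h)
  have hmarkov := mul_meas_ge_le_integral_of_nonneg
    (ae_of_all μ fun ω => (Real.exp_pos _).le) hi (Real.exp L)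
  rw [← ofReal_measureReal]
  refine ENNReal.ofReal_le_ofReal ?_
  rw [Real.exp_neg, ← one_div, le_div_iff₀ (Real.exp_pos _), mul_comm]
  refine le_trans ?_ (hmarkov.trans h3)
  refine mul_le_mul_of_nonneg_left (measureReal_mono ?_) (Real.exp_pos _).le
  rintro ω ⟨hS, hV⟩
  refine Real.exp_le_exp.2 (hr.trans ?_)
  have hS' := mul_le_mul_of_nonneg_left hS (show 0 ≤ r / b by positivity)
  have hV' := mul_le_mul_of_nonneg_left hV (show 0 ≤ 3 / 4 * (r / b) ^ 2 by positivity)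
  have e1 : r / b * (b * Real.sqrt (4 * (v - 1) * L + 5 * L ^ 2)) =
      r * Real.sqrt (4 * (v - 1) * L + 5 * L ^ 2) := by field_simp
  have e2 : 3 / 4 * (r / b) ^ 2 * (v * b ^ 2) = 3 / 4 * r ^ 2 * v := by field_simp
  linarith

lemma exists_nat_bucket {x : ℝ} {n : ℕ} (hn : 1 ≤ n) (hx0 : 0 ≤ x) (hxn : x ≤ n) :
    ∃ j ∈ Finset.Icc 1 n, (j : ℝ) - 1 ≤ x ∧ x ≤ j := by
  refine ⟨max 1 ⌈x⌉₊, ?_, ?_, ?_⟩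
  · simp [hn, hxn]
  · have := Nat.ceil_lt_add_one hx0
    rw [Nat.cast_max, Nat.cast_one, sub_le_iff_le_add]
    exact max_le (by linarith) this.le
  · exact (Nat.le_ceil x).trans (by exact_mod_cast le_max_right _ _)

/-- A conditional Cantelli inequality with a threshold depending on the conditional variance. -/
lemma measure_gt_sqrt_condVar_le (hm : m' ≤ m) {X : Ω → ℝ} {b : ℝ} (hb0 : 0 < b)
    (hX : StronglyMeasurable[m] X) (hcond : μ[X | m'] =ᵐ[μ] 0)
    (hb : ∀ᵐ ω ∂μ, |X ω| ≤ b) {L : ℝ} (hL0 : 0 < L) (hL1 : L ≤ 1) :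
    μ {ω | Real.sqrt (4 * (μ[fun ω' => X ω' ^ 2 | m']) ω * L + 5 * b ^ 2 * L ^ 2) < X ω}
      ≤ ENNReal.ofReal (Real.exp (-L)) := by
  set V := μ[fun ω' => X ω' ^ 2 | m'] with hV
  have hVm : StronglyMeasurable[m'] V := stronglyMeasurable_condExp
  have hV0 : ∀ᵐ ω ∂μ, 0 ≤ V ω := condExp_sq_nonneg X
  have hXi := integrable_of_ae_abs_le hX hb
  have hX2i : Integrable (fun ω => X ω ^ 2) μ := integrable_of_ae_abs_le (hX.pow 2) (ae_abs_sq_le hb)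
  set W : Ω → ℝ := fun ω => max (V ω) 0 with hW
  have hWm : StronglyMeasurable[m'] W := by
    exact (hVm.measurable.max measurable_const).stronglyMeasurable
  have hW0 : ∀ ω, 0 ≤ W ω := fun ω => le_max_right _ _
  have hWV : ∀ᵐ ω ∂μ, W ω = V ω := hV0.mono fun ω h => max_eq_left h
  set s : Ω → ℝ := fun ω => Real.sqrt (4 * W ω * L + 5 * b ^ 2 * L ^ 2) with hs
  have hsm : StronglyMeasurable[m'] s := Real.continuous_sqrt.comp_stronglyMeasurable
    (((hWm.const_mul 4).mul_const L).add stronglyMeasurable_const)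
  have hs2 : ∀ ω, s ω ^ 2 = 4 * W ω * L + 5 * b ^ 2 * L ^ 2 := fun ω =>
    Real.sq_sqrt (by have := hW0 ω; positivity)
  have hspos : ∀ ω, 0 < s ω := fun ω =>
    Real.sqrt_pos.2 (by have := hW0 ω; positivity)
  set D : Ω → ℝ := fun ω => s ω ^ 2 + W ω with hD
  have hDm : StronglyMeasurable[m'] D := (hsm.pow 2).add hWm
  have hDpos : ∀ ω, 0 < D ω := fun ω => by have := hspos ω; have := hW0 ω; positivity
  set p : Ω → ℝ := fun ω => s ω / D ω with hp
  have hpm : StronglyMeasurable[m'] p := by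
    exact (hsm.measurable.div hDm.measurable).stronglyMeasurable
  set q : Ω → ℝ := fun ω => W ω / D ω with hq
  have hqm : StronglyMeasurable[m'] q := by
    exact (hWm.measurable.div hDm.measurable).stronglyMeasurable
  have hq0 : ∀ ω, 0 ≤ q ω := fun ω => div_nonneg (hW0 ω) (hDpos ω).le
  have hq1 : ∀ ω, q ω ≤ 1 := fun ω => (div_le_one (hDpos ω)).2 (by
    simp only [hD]; nlinarith [sq_nonneg (s ω)])
  have hp0 : ∀ ω, 0 ≤ p ω := fun ω => div_nonneg (hspos ω).le (hDpos ω).le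
  set K := Real.sqrt (5 * b ^ 2 * L ^ 2) with hK
  have hKpos : 0 < K := Real.sqrt_pos.2 (by positivity)
  have hKs : ∀ ω, K ≤ s ω := fun ω => Real.sqrt_le_sqrt (by
    have := hW0 ω
    have : 0 ≤ 4 * W ω * L := by positivity
    linarith)
  have hp1 : ∀ ω, p ω ≤ 1 / K := fun ω => by
    rw [hp, div_le_div_iff₀ (hDpos ω) hKpos]
    simp only [hD]
    nlinarith [hKs ω, hspos ω, hW0 ω]
  have hp2 : ∀ᵐ ω ∂μ, |p ω ^ 2| ≤ (1 / K) ^ 2 := ae_of_all _ fun ω => by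
    rw [abs_of_nonneg (sq_nonneg _)]
    exact pow_le_pow_left₀ (hp0 ω) (hp1 ω) 2
  have hpq : ∀ᵐ ω ∂μ, |2 * p ω * q ω| ≤ 2 * (1 / K) * 1 := ae_of_all _ fun ω => by
    have := hp0 ω
    have := hq0 ω
    rw [abs_of_nonneg (by positivity)]
    gcongr
    · exact hp1 ω
    · exact hq1 ω
  have hq2 : ∀ᵐ ω ∂μ, |q ω ^ 2| ≤ 1 := ae_of_all _ fun ω => by
    rw [abs_of_nonneg (sq_nonneg _)]
    exact pow_le_one₀ (hq0 ω) (hq1 ω)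
  have hp2m : StronglyMeasurable[m'] (fun ω => p ω ^ 2) := hpm.pow 2
  have hpqm : StronglyMeasurable[m'] (fun ω => 2 * p ω * q ω) := (hpm.const_mul 2).mul hqm
  have i1 : Integrable (fun ω => p ω ^ 2 * X ω ^ 2) μ :=
    hX2i.bdd_mul (hp2m.mono hm).aestronglyMeasurable hp2
  have i2 : Integrable (fun ω => 2 * p ω * q ω * X ω) μ :=
    hXi.bdd_mul (hpqm.mono hm).aestronglyMeasurable hpq
  have i3 : Integrable (fun ω => q ω ^ 2) μ := integrable_of_ae_abs_le ((hqm.pow 2).mono hm) hq2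
  have i1' : Integrable (fun ω => p ω ^ 2 * V ω) μ :=
    integrable_condExp.bdd_mul (hp2m.mono hm).aestronglyMeasurable hp2
  have hexp : (fun ω => (p ω * X ω + q ω) ^ 2) =
      fun ω => p ω ^ 2 * X ω ^ 2 + 2 * p ω * q ω * X ω + q ω ^ 2 := by
    funext ω
    ring
  have hint : Integrable (fun ω => (p ω * X ω + q ω) ^ 2) μ := by
    rw [hexp]
    exact (i1.add i2).add i3
  have hzero : ∫ ω, 2 * p ω * q ω * X ω ∂μ = 0 := by
    refine (integral_mul_condExp_of_bounded hm hpqm hpq hXi).trans ?_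
    refine integral_eq_zero_of_ae ?_
    filter_upwards [hcond] with ω h
    simp [h]
  have hsq : ∫ ω, p ω ^ 2 * X ω ^ 2 ∂μ = ∫ ω, p ω ^ 2 * V ω ∂μ :=
    integral_mul_condExp_of_bounded hm hp2m hp2 hX2i
  have hle : ∫ ω, (p ω * X ω + q ω) ^ 2 ∂μ ≤ Real.exp (-L) := by
    calc ∫ ω, (p ω * X ω + q ω) ^ 2 ∂μ = ∫ ω, p ω ^ 2 * V ω + q ω ^ 2 ∂μ := by
          have h12 : Integrable (fun ω => p ω ^ 2 * X ω ^ 2 + 2 * p ω * q ω * X ω) μ := i1.add i2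
          rw [hexp, integral_add h12 i3, integral_add i1 i2, hzero, hsq, add_zero,
            integral_add i1' i3]
      _ ≤ ∫ _, Real.exp (-L) ∂μ := by
          refine integral_mono_ae (i1'.add i3) (integrable_const _) ?_
          filter_upwards [hWV] with ω h
          have hd := hDpos ω
          have e : p ω ^ 2 * V ω + q ω ^ 2 = W ω / D ω := by
            rw [← h]
            simp only [hp, hq]
            field_simp
            simp only [hD]
            ring
          have hWD : W ω * Real.exp L ≤ D ω := by
            have h1 := Real.exp_le_one_add_add_three_quarters_sq
              (show |L| ≤ 1 by rwa [abs_of_pos hL0])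
            have h2 : Real.exp L ≤ 1 + 4 * L := by nlinarith
            have h3 := mul_le_mul_of_nonneg_left h2 (hW0 ω)
            simp only [hD, hs2]
            have : 0 ≤ 5 * b ^ 2 * L ^ 2 := by positivity
            linarith
          rw [e, Real.exp_neg, ← one_div, div_le_div_iff₀ hd (Real.exp_pos _), one_mul]
          exact hWD
      _ = Real.exp (-L) := by simp
  have hmarkov := mul_meas_ge_le_integral_of_nonneg
    (ae_of_all μ fun ω => sq_nonneg (p ω * X ω + q ω)) hint 1
  rw [one_mul] at hmarkov
  calc _ ≤ μ {ω | 1 ≤ (p ω * X ω + q ω) ^ 2} := by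
        refine measure_mono_ae ?_
        filter_upwards [hWV] with ω h hlt
        change Real.sqrt (4 * V ω * L + 5 * b ^ 2 * L ^ 2) < X ω at hlt
        rw [← h] at hlt
        change s ω < X ω at hlt
        change 1 ≤ (p ω * X ω + q ω) ^ 2
        refine one_le_pow₀ ?_
        have e : p ω * s ω + q ω = 1 := by
          have hd := (hDpos ω).ne'
          simp only [hp, hq]
          field_simp
          simp only [hD]
        have := mul_le_mul_of_nonneg_left hlt.le (hp0 ω)
        linarith
    _ ≤ _ := by
        rw [← ofReal_measureReal]
        exact ENNReal.ofReal_le_ofReal (hmarkov.trans hle)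

end

/-- Freedman/Bernstein-type concentration inequality for martingale difference
sequences (Lemma 4.4 of Bubeck–Slivkins). -/
theorem stmt_0 {Ω : Type*} {m : MeasurableSpace Ω} {μ : Measure Ω}
    [IsProbabilityMeasure μ] (n : ℕ) (hn : 1 ≤ n)
    (F : Filtration ℕ m) (X : ℕ → Ω → ℝ) (b : ℝ) (hb : 0 < b)
    (hmeas : ∀ t ∈ Finset.Icc 1 n, StronglyMeasurable[F t] (X t))
    (hcond : ∀ t ∈ Finset.Icc 1 n, μ[X t | F (t - 1)] =ᵐ[μ] 0)
    (hbdd : ∀ t ∈ Finset.Icc 1 n, ∀ᵐ ω ∂μ, |X t ω| ≤ b)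
    (δ : ℝ) (hδ0 : 0 < δ) (hδ1 : δ < 1) :
    ENNReal.ofReal (1 - δ) ≤
      μ {ω | ∑ t ∈ Finset.Icc 1 n, X t ω ≤
        Real.sqrt (4 * (∑ t ∈ Finset.Icc 1 n,
            (μ[fun ω' => (X t ω') ^ 2 | F (t - 1)]) ω) * Real.log (n / δ)
          + 5 * b ^ 2 * Real.log (n / δ) ^ 2)} := by
  set L := Real.log (n / δ) with hLdef
  have hn' : (1 : ℝ) ≤ n := by exact_mod_cast hn
  have hexpL : n * Real.exp (-L) = δ := by
    rw [Real.exp_neg, hLdef, Real.exp_log (by positivity)]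
    field_simp
  set G := {ω | ∑ t ∈ Finset.Icc 1 n, X t ω ≤
        Real.sqrt (4 * (∑ t ∈ Finset.Icc 1 n,
            (μ[fun ω' => (X t ω') ^ 2 | F (t - 1)]) ω) * L + 5 * b ^ 2 * L ^ 2)} with hG
  suffices hbad : μ Gᶜ ≤ ENNReal.ofReal δ by
    rw [ENNReal.ofReal_sub 1 hδ0.le, ENNReal.ofReal_one, tsub_le_iff_right]
    calc (1 : ENNReal) = μ (G ∪ Gᶜ) := by rw [Set.union_compl_self, measure_univ]
      _ ≤ μ G + μ Gᶜ := measure_union_le _ _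
      _ ≤ μ G + ENNReal.ofReal δ := by gcongr
  by_cases hL : 3 / 5 ≤ L
  · have hV0 : ∀ᵐ ω ∂μ, ∀ t ∈ Finset.Icc 1 n,
        0 ≤ (μ[fun ω' => (X t ω') ^ 2 | F (t - 1)]) ω :=
      (Finset.eventually_all _).2 fun t _ => condExp_sq_nonneg (X t)
    have hVb : ∀ᵐ ω ∂μ, ∀ t ∈ Finset.Icc 1 n,
        (μ[fun ω' => (X t ω') ^ 2 | F (t - 1)]) ω ≤ b ^ 2 :=
      (Finset.eventually_all _).2 fun t ht =>
        condExp_sq_le (F.le _) ((hmeas t ht).mono (F.le _)) (hbdd t ht)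
    calc μ Gᶜ ≤ μ (⋃ j ∈ Finset.Icc 1 n,
          {ω | b * Real.sqrt (4 * ((j : ℝ) - 1) * L + 5 * L ^ 2) ≤ ∑ t ∈ Finset.Icc 1 n, X t ω ∧
            ∑ t ∈ Finset.Icc 1 n, (μ[fun ω' => X t ω' ^ 2 | F (t - 1)]) ω ≤ j * b ^ 2}) := by
          refine measure_mono_ae ?_
          filter_upwards [hV0, hVb] with ω h0 hle hω
          change ω ∈ Gᶜ at hω
          rw [hG, Set.mem_compl_iff, Set.mem_ofPred_eq, not_le] at hω
          have hS0 := Finset.sum_nonneg h0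
          have hSn := Finset.sum_le_card_nsmul _ _ _ hle
          set v := ∑ t ∈ Finset.Icc 1 n, (μ[fun ω' => (X t ω') ^ 2 | F (t - 1)]) ω
          simp only [Nat.card_Icc, Nat.add_sub_cancel, nsmul_eq_mul] at hSn
          have hb2 : 0 < b ^ 2 := by positivity
          obtain ⟨j, hj, hj1, hj2⟩ := exists_nat_bucket hn (div_nonneg hS0 hb2.le)
            ((div_le_iff₀ hb2).2 hSn)
          change ω ∈ ⋃ j ∈ Finset.Icc 1 n, _
          simp only [Set.mem_iUnion]
          refine ⟨j, hj, ?_, (div_le_iff₀ hb2).1 hj2⟩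
          rw [le_div_iff₀ hb2] at hj1
          refine le_trans ?_ hω.le
          nth_rewrite 1 [← Real.sqrt_sq hb.le]
          rw [← Real.sqrt_mul (sq_nonneg b)]
          refine Real.sqrt_le_sqrt ?_
          nlinarith [mul_le_mul_of_nonneg_right hj1 (show 0 ≤ L by linarith)]
      _ ≤ ∑ j ∈ Finset.Icc 1 n, ENNReal.ofReal (Real.exp (-L)) := by
          refine (measure_biUnion_finset_le _ _).trans (Finset.sum_le_sum fun j hj => ?_)
          exact measure_sum_ge_and_variation_le n F X hb hmeas hcond hbdd
            (by exact_mod_cast (Finset.mem_Icc.1 hj).1) hL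
      _ = ENNReal.ofReal δ := by
          rw [Finset.sum_const, Nat.card_Icc, Nat.add_sub_cancel, nsmul_eq_mul, ← hexpL,
            ENNReal.ofReal_mul (by positivity), ENNReal.ofReal_natCast]
  · push Not at hL
    have hn1 : n = 1 := by
      by_contra hne
      have h2 : (2 : ℝ) ≤ n := by exact_mod_cast (show 2 ≤ n by omega)
      have h3 : Real.log 2 ≤ L := Real.log_le_log (by norm_num)
        (h2.trans (le_div_self (by linarith) hδ0 hδ1.le))
      linarith [Real.log_two_gt_d9]
    subst hn1
    have hL0 : 0 < L := Real.log_pos (by rw [lt_div_iff₀ hδ0]; simpa using hδ1)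
    have h1 : 1 ∈ Finset.Icc 1 1 := by simp
    have h := measure_gt_sqrt_condVar_le (F.le 0) hb ((hmeas 1 h1).mono (F.le 1)) (hcond 1 h1)
      (hbdd 1 h1) hL0 (by linarith)
    rw [Nat.cast_one, one_mul] at hexpL
    rw [← hexpL]
    refine le_trans (measure_mono fun ω hω => ?_) h
    simpa [hG] using hω
end

section
/- Let (F_s)_{s=0}^t be a filtration, and for each round s = 1,...,t let O_s be an F_s-measurable event ('arm i is observed at round s') whose conditional probability q_s = P(O_s | F_{s-1}) is F_{s-1}-measurable and almost surely satisfies q_s ≥ γ_s/D for s ≤ min(t, τ') and q_s ≥ γ_s τ'/(D s) for τ' < s ≤ t. Let r_1, ..., r_t ∈ [0,1] be deterministic rewards and define the importance-weighted estimates r̃_s = r_s · 1[O_s] / q_s. Then for every δ ∈ (0,1), with probability at least 1 − 2δ, |(1/t) Σ_{s=1}^t r̃_s − (1/t) Σ_{s=1}^t r_s| ≤ Radius_t, where Radius_t = sqrt( 4 ( (D/t²) Σ_{s=1}^{min(t,τ')} 1/γ_s + D·max(t − τ', 0)/(γ_t τ' t) ) log(t/δ) + (5 D² / (γ_t² ·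 min(t,τ')²)) log²(t/δ) ). -/
open MeasureTheory Finset

/-- One step of the exponential supermartingale argument for importance-weighted estimates: the
centred estimate `r * 1_O / q - r` has conditional moment generating function at most
`exp (l ^ 2 * v)` at `l`, as soon as `q⁻¹ ≤ v` and `|l| * v ≤ 1`. -/
lemma integral_mul_exp_importance_weighted_le {Ω : Type*} {m₀ m : MeasurableSpace Ω}
    {μ : Measure Ω} [IsProbabilityMeasure μ] (hm : m₀ ≤ m) {A q : Ω → ℝ} {O : Set Ω}
    (hA : StronglyMeasurable[m₀] A) (hA0 : ∀ ω, 0 ≤ A ω) (hAint : Integrable A μ)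
    (hO : MeasurableSet O) (hq : StronglyMeasurable[m₀] q)
    (hqcond : q =ᵐ[μ] μ[O.indicator (fun _ => (1 : ℝ)) | m₀])
    {v : ℝ} (hv : 0 < v) (hlow : ∀ᵐ ω ∂μ, v⁻¹ ≤ q ω)
    {r : ℝ} (hr0 : 0 ≤ r) (hr1 : r ≤ 1) {l : ℝ} (hl : |l| * v ≤ 1) :
    Integrable (fun ω => A ω *
        Real.exp (l * (r * O.indicator (fun _ => (1 : ℝ)) ω / q ω - r))) μ ∧
      ∫ ω, A ω * Real.exp (l * (r * O.indicator (fun _ => (1 : ℝ)) ω / q ω - r)) ∂μ ≤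
        Real.exp (l ^ 2 * v) * ∫ ω, A ω ∂μ := by
  set I : Ω → ℝ := O.indicator (fun _ => (1 : ℝ)) with hI
  have hI01 : ∀ ω, I ω = 0 ∨ I ω = 1 := fun ω => by
    by_cases h : ω ∈ O <;> simp [hI, h]
  have hIm : StronglyMeasurable I := stronglyMeasurable_const.indicator hO
  have hIint : Integrable I μ := (integrable_const (1 : ℝ)).indicator hO
  have hq1 : ∀ᵐ ω ∂μ, q ω ≤ 1 := by
    have h := condExp_mono (m := m₀) hIint (integrable_const (1 : ℝ))
      (Filter.Eventually.of_forall fun ω => by rcases hI01 ω with h | h <;> simp [h])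
    rw [condExp_const hm] at h
    filter_upwards [h, hqcond] with ω h1 h2
    rw [h2]
    exact h1
  have hinv : ∀ᵐ ω ∂μ, 0 < q ω ∧ 1 ≤ (q ω)⁻¹ ∧ (q ω)⁻¹ ≤ v := by
    filter_upwards [hq1, hlow] with ω h1 h2
    have h0 : 0 < q ω := (inv_pos.2 hv).trans_le h2
    exact ⟨h0, (one_le_inv₀ h0).2 h1, inv_le_of_inv_le₀ hv h2⟩
  have hsmall : ∀ᵐ ω ∂μ, |l * (r * I ω / q ω - r)| ≤ 1 := by
    filter_upwards [hinv] with ω ⟨h0, h1, h2⟩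
    rw [abs_mul]
    refine le_trans (mul_le_mul_of_nonneg_left ?_ (abs_nonneg l)) hl
    rw [div_eq_mul_inv]
    rcases hI01 ω with h | h <;> rw [h, abs_le] <;> constructor <;> nlinarith
  have hAm : StronglyMeasurable A := hA.mono hm
  have hqm : StronglyMeasurable q := hq.mono hm
  -- the coefficient of the indicator in the quadratic upper bound
  set g : Ω → ℝ := fun ω => (l * r - 2 * l ^ 2 * r ^ 2) * (q ω)⁻¹ + l ^ 2 * r ^ 2 * (q ω)⁻¹ ^ 2
    with hg
  have hqinv : StronglyMeasurable[m₀] fun ω => (q ω)⁻¹ := hq.measurable.inv.stronglyMeasurable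
  have hgm : StronglyMeasurable[m₀] g :=
    (hqinv.const_mul _).add ((hqinv.pow 2).const_mul _)
  have hqinv_bdd : ∀ᵐ ω ∂μ, ‖(q ω)⁻¹‖ ≤ v := by
    filter_upwards [hinv] with ω ⟨h0, h1, h2⟩
    rwa [Real.norm_of_nonneg (by positivity)]
  have hAq : Integrable (fun ω => A ω * (q ω)⁻¹) μ :=
    hAint.mul_bdd (hqinv.mono hm).aestronglyMeasurable hqinv_bdd
  have hAqq : Integrable (fun ω => A ω * (q ω)⁻¹ * (q ω)⁻¹) μ :=
    hAq.mul_bdd (hqinv.mono hm).aestronglyMeasurable hqinv_bdd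
  have hAg : Integrable (fun ω => A ω * g ω) μ := by
    have := (hAq.const_mul (l * r - 2 * l ^ 2 * r ^ 2)).add (hAqq.const_mul (l ^ 2 * r ^ 2))
    refine this.congr (Filter.Eventually.of_forall fun ω => ?_)
    simp only [hg, Pi.add_apply]
    ring
  have hAgI : Integrable (fun ω => A ω * g ω * I ω) μ :=
    hAg.mul_bdd (c := 1) hIm.aestronglyMeasurable
      (Filter.Eventually.of_forall fun ω => by rcases hI01 ω with h | h <;> simp [h])
  have hswap : ∫ ω, A ω * g ω * I ω ∂μ = ∫ ω, A ω * g ω * q ω ∂μ := by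
    have h := condExp_mul_of_stronglyMeasurable_left (μ := μ) (hA.mul hgm)
      (g := I) hAgI hIint
    rw [← integral_condExp hm (f := fun ω => A ω * g ω * I ω)]
    refine integral_congr_ae ?_
    filter_upwards [h, hqcond] with ω h1 h2
    rw [h2]
    exact h1
  have hexpint : Integrable (fun ω => A ω * Real.exp (l * (r * I ω / q ω - r))) μ := by
    refine hAint.mul_bdd (c := Real.exp 1) ?_ ?_
    · exact (Real.measurable_exp.comp ((((hIm.measurable.const_mul r).div
        hqm.measurable).sub_const r).const_mul l)).aestronglyMeasurable
    · filter_upwards [hsmall] with ω h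
      rw [Real.norm_of_nonneg (Real.exp_pos _).le]
      exact Real.exp_le_exp.2 ((le_abs_self _).trans h)
  refine ⟨hexpint, ?_⟩
  calc ∫ ω, A ω * Real.exp (l * (r * I ω / q ω - r)) ∂μ
      ≤ ∫ ω, (1 - l * r + l ^ 2 * r ^ 2) * A ω + A ω * g ω * I ω ∂μ := by
        refine integral_mono_ae hexpint ((hAint.const_mul _).add hAgI) ?_
        filter_upwards [hsmall] with ω h
        have h3 := (abs_le.1 (Real.abs_exp_sub_one_sub_id_le h)).2
        have h4 : Real.exp (l * (r * I ω / q ω - r)) ≤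
            (1 - l * r + l ^ 2 * r ^ 2) + g ω * I ω := by
          refine (show _ ≤ 1 + l * (r * I ω / q ω - r) + (l * (r * I ω / q ω - r)) ^ 2 by
            linarith).trans (le_of_eq ?_)
          simp only [hg, div_eq_mul_inv]
          rcases hI01 ω with h | h <;> rw [h] <;> ring
        have := mul_le_mul_of_nonneg_left h4 (hA0 ω)
        linarith
    _ = (1 - l * r + l ^ 2 * r ^ 2) * ∫ ω, A ω ∂μ + ∫ ω, A ω * g ω * q ω ∂μ := by
        rw [integral_add (hAint.const_mul _) hAgI, integral_const_mul, hswap]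
    _ = (1 - l * r + l ^ 2 * r ^ 2) * ∫ ω, A ω ∂μ + ((l * r - 2 * l ^ 2 * r ^ 2) * ∫ ω, A ω ∂μ
          + l ^ 2 * r ^ 2 * ∫ ω, A ω * (q ω)⁻¹ ∂μ) := by
        rw [← integral_const_mul (l * r - 2 * l ^ 2 * r ^ 2), ← integral_const_mul (l ^ 2 * r ^ 2),
          ← integral_add (hAint.const_mul _) (hAq.const_mul _)]
        congr 1
        refine integral_congr_ae ?_
        filter_upwards [hinv] with ω ⟨h0, _, _⟩
        simp only [hg]
        field_simp
    _ ≤ (1 + l ^ 2 * v) * ∫ ω, A ω ∂μ := by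
        have h1 : ∫ ω, A ω * (q ω)⁻¹ ∂μ ≤ v * ∫ ω, A ω ∂μ := by
          rw [← integral_const_mul]
          refine integral_mono_ae hAq (hAint.const_mul _) ?_
          filter_upwards [hinv] with ω ⟨_, _, h2⟩
          have := mul_le_mul_of_nonneg_left h2 (hA0 ω)
          linarith
        have h0 : 0 ≤ ∫ ω, A ω ∂μ := integral_nonneg hA0
        have hr2 : r ^ 2 ≤ 1 := pow_le_one₀ hr0 hr1
        have h2 : l ^ 2 * r ^ 2 * ∫ ω, A ω * (q ω)⁻¹ ∂μ ≤ l ^ 2 * r ^ 2 * (v * ∫ ω, A ω ∂μ) :=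
          mul_le_mul_of_nonneg_left h1 (by positivity)
        have h3 : l ^ 2 * r ^ 2 * (v * ∫ ω, A ω ∂μ) ≤ l ^ 2 * (v * ∫ ω, A ω ∂μ) :=
          mul_le_mul_of_nonneg_right (mul_le_of_le_one_right (sq_nonneg l) hr2) (by positivity)
        have h4 : 0 ≤ l ^ 2 * r ^ 2 * ∫ ω, A ω ∂μ := by positivity
        linarith
    _ ≤ Real.exp (l ^ 2 * v) * ∫ ω, A ω ∂μ := by
        refine mul_le_mul_of_nonneg_right ?_ (integral_nonneg hA0)
        linarith [Real.add_one_le_exp (l ^ 2 * v)]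

/-- A sub-gamma type tail bound: if the moment generating function of `S` is at most
`exp (l ^ 2 * V)` for `|l| * R ≤ 1`, then `|S|` exceeds `x` with probability at most
`2 * exp (-L)` whenever `4 * V * L + 5 * R ^ 2 * L ^ 2 ≤ x ^ 2`. -/
lemma measureReal_abs_ge_le_of_mgf_le {Ω : Type*} {m : MeasurableSpace Ω} {μ : Measure Ω}
    [IsProbabilityMeasure μ] {S : Ω → ℝ} {V R L x : ℝ} (hV : 0 < V) (hR : 0 < R) (hL : 0 ≤ L)
    (hx : 0 ≤ x) (hxL : 4 * V * L + 5 * R ^ 2 * L ^ 2 ≤ x ^ 2)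
    (hS : ∀ l : ℝ, |l| * R ≤ 1 → Integrable (fun ω => Real.exp (l * S ω)) μ ∧
      ProbabilityTheory.mgf S μ l ≤ Real.exp (l ^ 2 * V)) :
    μ.real {ω | x ≤ |S ω|} ≤ 2 * Real.exp (-L) := by
  obtain ⟨l, hl0, hlR, hl⟩ : ∃ l : ℝ, 0 ≤ l ∧ l * R ≤ 1 ∧ -l * x + l ^ 2 * V ≤ -L := by
    rcases le_total (x * R) (2 * V) with h | h
    · refine ⟨x / (2 * V), by positivity, ?_, ?_⟩
      · rw [div_mul_eq_mul_div]
        exact (div_le_one (by positivity)).2 h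
      · have h1 : -(x / (2 * V)) * x + (x / (2 * V)) ^ 2 * V = -(x ^ 2 / (4 * V)) := by
          field_simp
          ring
        rw [h1, neg_le_neg_iff, le_div_iff₀ (by positivity)]
        nlinarith [sq_nonneg (R * L)]
    · refine ⟨1 / R, by positivity, by field_simp; exact le_rfl, ?_⟩
      have h2 : 2 * R * L ≤ x := by
        refine abs_le_of_sq_le_sq' ?_ hx |>.2
        nlinarith [sq_nonneg (R * L), mul_nonneg hV.le hL]
      have h1 : -(1 / R) * x + (1 / R) ^ 2 * V = (-x * R + V) / R ^ 2 := by
        field_simp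
      rw [h1, div_le_iff₀ (by positivity)]
      nlinarith
  have hlR' : |l| * R ≤ 1 := by rwa [abs_of_nonneg hl0]
  have hup := hS l hlR'
  have hdown := hS (-l) (by rwa [abs_neg])
  have h1 : μ.real {ω | x ≤ S ω} ≤ Real.exp (-L) :=
    calc μ.real {ω | x ≤ S ω} ≤ Real.exp (-l * x) * ProbabilityTheory.mgf S μ l :=
          ProbabilityTheory.measure_ge_le_exp_mul_mgf x hl0 hup.1
      _ ≤ Real.exp (-l * x) * Real.exp (l ^ 2 * V) := by gcongr; exact hup.2
      _ ≤ Real.exp (-L) := by rw [← Real.exp_add]; exact Real.exp_le_exp.2 hl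
  have h2 : μ.real {ω | S ω ≤ -x} ≤ Real.exp (-L) :=
    calc μ.real {ω | S ω ≤ -x} ≤ Real.exp (-(-l) * -x) * ProbabilityTheory.mgf S μ (-l) :=
          ProbabilityTheory.measure_le_le_exp_mul_mgf (-x) (by linarith) hdown.1
      _ ≤ Real.exp (-(-l) * -x) * Real.exp ((-l) ^ 2 * V) := by gcongr; exact hdown.2
      _ ≤ Real.exp (-L) := by
          rw [← Real.exp_add]
          refine Real.exp_le_exp.2 (le_trans (le_of_eq ?_) hl)
          ring
  calc μ.real {ω | x ≤ |S ω|} ≤ μ.real ({ω | x ≤ S ω} ∪ {ω | S ω ≤ -x}) := by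
        refine measureReal_mono fun ω (hω : x ≤ |S ω|) => ?_
        rcases le_abs.1 hω with h | h
        · exact Or.inl h
        · exact Or.inr (show S ω ≤ -x by linarith)
    _ ≤ μ.real {ω | x ≤ S ω} + μ.real {ω | S ω ≤ -x} := measureReal_union_le _ _
    _ ≤ 2 * Real.exp (-L) := by linarith

/-- Moment generating function bound for the sum of the centred importance-weighted estimates
`r s * 1_{O s} / q s - r s`, when `(q s)⁻¹ ≤ v s` and `|l| * v s ≤ 1`. -/
lemma mgf_sum_importance_weighted_le {Ω : Type*} {m : MeasurableSpace Ω} {μ : Measure Ω}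
    [IsProbabilityMeasure μ] (t : ℕ) (F : Filtration ℕ m)
    (O : ℕ → Set Ω) (hO : ∀ s ∈ Finset.Icc 1 t, MeasurableSet[F s] (O s))
    (q : ℕ → Ω → ℝ)
    (hqcond : ∀ s ∈ Finset.Icc 1 t,
      q s =ᵐ[μ] μ[(O s).indicator (fun _ => (1 : ℝ)) | F (s - 1)])
    (hqmeas : ∀ s ∈ Finset.Icc 1 t, StronglyMeasurable[F (s - 1)] (q s))
    (v : ℕ → ℝ) (hv : ∀ s ∈ Finset.Icc 1 t, 0 < v s)
    (hlow : ∀ s ∈ Finset.Icc 1 t, ∀ᵐ ω ∂μ, (v s)⁻¹ ≤ q s ω)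
    (r : ℕ → ℝ) (hr : ∀ s ∈ Finset.Icc 1 t, r s ∈ Set.Icc (0 : ℝ) 1)
    (l : ℝ) (hl : ∀ s ∈ Finset.Icc 1 t, |l| * v s ≤ 1) :
    Integrable (fun ω => Real.exp (l * ∑ s ∈ Finset.Icc 1 t,
        (r s * (O s).indicator (fun _ => (1 : ℝ)) ω / q s ω - r s))) μ ∧
      ProbabilityTheory.mgf (fun ω => ∑ s ∈ Finset.Icc 1 t,
        (r s * (O s).indicator (fun _ => (1 : ℝ)) ω / q s ω - r s)) μ l ≤
        Real.exp (l ^ 2 * ∑ s ∈ Finset.Icc 1 t, v s) := by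
  set X : ℕ → Ω → ℝ := fun s ω => r s * (O s).indicator (fun _ => (1 : ℝ)) ω / q s ω - r s
    with hX
  have hXm : ∀ s ∈ Finset.Icc 1 t, StronglyMeasurable[F s] (X s) := fun s hs => by
    have h1 : Measurable[F s] ((O s).indicator fun _ => (1 : ℝ)) :=
      measurable_const.indicator (hO s hs)
    have h2 : Measurable[F s] (q s) := ((hqmeas s hs).mono (F.mono (Nat.sub_le s 1))).measurable
    exact (((h1.const_mul (r s)).div h2).sub_const (r s)).stronglyMeasurable
  have key : ∀ n ≤ t, Integrable (fun ω => Real.exp (l * ∑ s ∈ Finset.Icc 1 n, X s ω)) μ ∧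
      ∫ ω, Real.exp (l * ∑ s ∈ Finset.Icc 1 n, X s ω) ∂μ ≤
        Real.exp (l ^ 2 * ∑ s ∈ Finset.Icc 1 n, v s) := by
    intro n
    induction n with
    | zero => intro _; simp
    | succ n ih =>
      intro hn
      obtain ⟨ih1, ih2⟩ := ih (by omega)
      have hmem : n + 1 ∈ Finset.Icc 1 t := Finset.mem_Icc.2 ⟨by omega, hn⟩
      have hA : StronglyMeasurable[F n]
          (fun ω => Real.exp (l * ∑ s ∈ Finset.Icc 1 n, X s ω)) := by
        refine Real.continuous_exp.comp_stronglyMeasurable (StronglyMeasurable.const_mul ?_ l)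
        refine Finset.stronglyMeasurable_fun_sum _ fun s hs => ?_
        have hs' := Finset.mem_Icc.1 hs
        exact (hXm s (Finset.mem_Icc.2 ⟨hs'.1, by omega⟩)).mono (F.mono hs'.2)
      have hstep := integral_mul_exp_importance_weighted_le (F.le n) hA
        (fun ω => (Real.exp_pos _).le) ih1 (F.le _ _ (hO _ hmem)) (hqmeas _ hmem)
        (hqcond _ hmem) (hv _ hmem) (hlow _ hmem) (hr _ hmem).1 (hr _ hmem).2 (hl _ hmem)
      have hsplit : ∀ ω, Real.exp (l * ∑ s ∈ Finset.Icc 1 (n + 1), X s ω) =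
          Real.exp (l * ∑ s ∈ Finset.Icc 1 n, X s ω) * Real.exp (l * X (n + 1) ω) := fun ω => by
        rw [Finset.sum_Icc_succ_top (by omega), mul_add, Real.exp_add]
      simp_rw [hsplit]
      refine ⟨hstep.1, hstep.2.trans ?_⟩
      rw [Finset.sum_Icc_succ_top (by omega), mul_add, Real.exp_add, mul_comm]
      exact mul_le_mul_of_nonneg_right ih2 (Real.exp_pos _).le
  exact key t le_rfl

/-- Adversarial-setting half of the concentration lemma: the importance-weighted
running average `(1/t) ∑ r̃_s` concentrates around the running average
`(1/t) ∑ r_s` within the confidence radius `Radius_t`, with probability at least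
`1 - 2δ`.  Here `τ' : ℕ` with `τ' ≥ 1`; any `τ' > t` plays the role of `τ' = ∞`
(the second variance summand then vanishes since `max (t - τ') 0 = 0`). -/
theorem stmt_2 {Ω : Type*} {m : MeasurableSpace Ω} {μ : Measure Ω}
    [IsProbabilityMeasure μ] (t : ℕ) (ht : 1 ≤ t)
    (F : Filtration ℕ m)
    (O : ℕ → Set Ω) (hO : ∀ s ∈ Finset.Icc 1 t, MeasurableSet[F s] (O s))
    (q : ℕ → Ω → ℝ)
    (hqcond : ∀ s ∈ Finset.Icc 1 t,
      q s =ᵐ[μ] μ[(O s).indicator (fun _ => (1 : ℝ)) | F (s - 1)])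
    (hqmeas : ∀ s ∈ Finset.Icc 1 t, StronglyMeasurable[F (s - 1)] (q s))
    (D : ℝ) (hD : 1 ≤ D)
    (γ : ℕ → ℝ) (hγpos : ∀ s ∈ Finset.Icc 1 t, 0 < γ s)
    (hγmono : ∀ s ∈ Finset.Icc 1 t, ∀ s' ∈ Finset.Icc 1 t, s ≤ s' → γ s' ≤ γ s)
    (τ' : ℕ) (hτ' : 1 ≤ τ')
    (hlow1 : ∀ s ∈ Finset.Icc 1 (min t τ'), ∀ᵐ ω ∂μ, γ s / D ≤ q s ω)
    (hlow2 : ∀ s ∈ Finset.Icc (τ' + 1) t,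
      ∀ᵐ ω ∂μ, γ s * (τ' : ℝ) / (D * s) ≤ q s ω)
    (r : ℕ → ℝ) (hr : ∀ s ∈ Finset.Icc 1 t, r s ∈ Set.Icc (0 : ℝ) 1)
    (δ : ℝ) (hδ0 : 0 < δ) (hδ1 : δ < 1) :
    ENNReal.ofReal (1 - 2 * δ) ≤
      μ {ω | |(1 / (t : ℝ)) * ∑ s ∈ Finset.Icc 1 t,
            r s * (O s).indicator (fun _ => (1 : ℝ)) ω / q s ω
          - (1 / (t : ℝ)) * ∑ s ∈ Finset.Icc 1 t, r s| ≤
        Real.sqrt (4 * ((D / (t : ℝ) ^ 2) *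
              (∑ s ∈ Finset.Icc 1 (min t τ'), 1 / γ s)
            + D * max ((t : ℝ) - (τ' : ℝ)) 0 / (γ t * (τ' : ℝ) * (t : ℝ)))
            * Real.log ((t : ℝ) / δ)
          + (5 * D ^ 2 / (γ t ^ 2 * ((min t τ' : ℕ) : ℝ) ^ 2))
            * Real.log ((t : ℝ) / δ) ^ 2)} := by
  have ht0 : (0 : ℝ) < t := by exact_mod_cast ht
  have hτ0 : (0 : ℝ) < τ' := by exact_mod_cast hτ'
  have hD0 : 0 < D := by linarith
  have htt : t ∈ Finset.Icc 1 t := Finset.mem_Icc.2 ⟨ht, le_rfl⟩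
  have hγt := hγpos t htt
  have hmin1 : 1 ≤ min t τ' := le_min ht hτ'
  have hmin0 : (0 : ℝ) < ((min t τ' : ℕ) : ℝ) := by exact_mod_cast hmin1
  set v : ℕ → ℝ := fun s => if s ≤ τ' then D / γ s else D * s / (γ s * τ') with hvdef
  have hspos : ∀ s ∈ Finset.Icc 1 t, (0 : ℝ) < s := fun s hs => by
    exact_mod_cast (Finset.mem_Icc.1 hs).1
  have hv : ∀ s ∈ Finset.Icc 1 t, 0 < v s := fun s hs => by
    have h1 := hγpos s hs
    have h2 := hspos s hs
    simp only [hvdef]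
    split_ifs <;> positivity
  have hlow : ∀ s ∈ Finset.Icc 1 t, ∀ᵐ ω ∂μ, (v s)⁻¹ ≤ q s ω := fun s hs => by
    have hs' := Finset.mem_Icc.1 hs
    by_cases h : s ≤ τ'
    · simp only [hvdef, if_pos h, inv_div]
      exact hlow1 s (Finset.mem_Icc.2 ⟨hs'.1, le_min hs'.2 h⟩)
    · simp only [hvdef, if_neg h, inv_div]
      exact hlow2 s (Finset.mem_Icc.2 ⟨by omega, hs'.2⟩)
  set R : ℝ := D * t / (γ t * ((min t τ' : ℕ) : ℝ)) with hR
  have hR0 : 0 < R := by positivity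
  have hvR : ∀ s ∈ Finset.Icc 1 t, v s ≤ R := fun s hs => by
    have hs' := Finset.mem_Icc.1 hs
    have h1 : γ t ≤ γ s := hγmono s hs t htt hs'.2
    have hst : (s : ℝ) ≤ t := by exact_mod_cast hs'.2
    by_cases h : s ≤ τ'
    · simp only [hvdef, if_pos h]
      have h2 : D / γ s ≤ D / γ t := by gcongr
      refine h2.trans ?_
      rw [hR, mul_div_mul_comm]
      refine le_mul_of_one_le_right (by positivity) ((one_le_div hmin0).2 ?_)
      exact_mod_cast min_le_left t τ'
    · simp only [hvdef, if_neg h, hR]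
      rw [min_eq_right (show τ' ≤ t by omega)]
      gcongr
  set W : ℝ := D * (∑ s ∈ Finset.Icc 1 (min t τ'), 1 / γ s)
    + D * t * max ((t : ℝ) - (τ' : ℝ)) 0 / (γ t * τ') with hW
  have hvW : ∑ s ∈ Finset.Icc 1 t, v s ≤ W := by
    rw [hvdef, Finset.sum_ite]
    have e1 : (Finset.Icc 1 t).filter (fun s => s ≤ τ') = Finset.Icc 1 (min t τ') := by
      ext s
      simp only [Finset.mem_filter, Finset.mem_Icc]
      omega
    have e2 : (Finset.Icc 1 t).filter (fun s => ¬ s ≤ τ') = Finset.Icc (τ' + 1) t := by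
      ext s
      simp only [Finset.mem_filter, Finset.mem_Icc]
      omega
    rw [e1, e2, hW, Finset.mul_sum]
    refine add_le_add (le_of_eq (Finset.sum_congr rfl fun s _ => by ring)) ?_
    have h1 : ∀ s ∈ Finset.Icc (τ' + 1) t, D * s / (γ s * τ') ≤ D * t / (γ t * τ') := by
      intro s hs
      have hs' := Finset.mem_Icc.1 hs
      have h1 : γ t ≤ γ s := hγmono s (Finset.mem_Icc.2 ⟨by omega, hs'.2⟩) t htt hs'.2
      have hst : (s : ℝ) ≤ t := by exact_mod_cast hs'.2
      gcongr
    refine (Finset.sum_le_card_nsmul _ _ _ h1).trans (le_of_eq ?_)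
    have hc : ((#(Finset.Icc (τ' + 1) t) : ℕ) : ℝ) = max ((t : ℝ) - (τ' : ℝ)) 0 := by
      rw [Nat.card_Icc]
      rcases le_total t τ' with h | h
      · have h' : (t : ℝ) ≤ τ' := by exact_mod_cast h
        rw [max_eq_right (by linarith), show t + 1 - (τ' + 1) = 0 by omega, Nat.cast_zero]
      · have h' : (τ' : ℝ) ≤ t := by exact_mod_cast h
        rw [max_eq_left (by linarith), show t + 1 - (τ' + 1) = t - τ' by omega, Nat.cast_sub h]
    rw [nsmul_eq_mul, hc]
    ring
  have hW0 : 0 < W := (Finset.sum_pos hv ⟨t, htt⟩).trans_le hvW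
  set L := Real.log ((t : ℝ) / δ) with hL
  have ht1 : (1 : ℝ) ≤ t := by exact_mod_cast ht
  have hL0 : 0 ≤ L := Real.log_nonneg ((one_le_div hδ0).2 (by linarith))
  have hexpL : Real.exp (-L) ≤ δ := by
    rw [Real.exp_neg, hL, Real.exp_log (by positivity), inv_div]
    exact div_le_self hδ0.le ht1
  set B : ℝ := 4 * ((D / (t : ℝ) ^ 2) * (∑ s ∈ Finset.Icc 1 (min t τ'), 1 / γ s)
      + D * max ((t : ℝ) - (τ' : ℝ)) 0 / (γ t * (τ' : ℝ) * (t : ℝ))) * L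
    + (5 * D ^ 2 / (γ t ^ 2 * ((min t τ' : ℕ) : ℝ) ^ 2)) * L ^ 2 with hB
  have hBeq : 4 * W * L + 5 * R ^ 2 * L ^ 2 = t ^ 2 * B := by
    rw [hB, hW, hR]
    field_simp
  have hB0 : 0 ≤ B := by
    have : 0 ≤ (t : ℝ) ^ 2 * B := by rw [← hBeq]; positivity
    exact nonneg_of_mul_nonneg_right this (by positivity)
  set S : Ω → ℝ := fun ω => ∑ s ∈ Finset.Icc 1 t,
    (r s * (O s).indicator (fun _ => (1 : ℝ)) ω / q s ω - r s) with hS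
  have htail : μ.real {ω | t * Real.sqrt B ≤ |S ω|} ≤ 2 * Real.exp (-L) := by
    refine measureReal_abs_ge_le_of_mgf_le hW0 hR0 hL0 (by positivity) ?_ fun l hl => ?_
    · rw [mul_pow, Real.sq_sqrt hB0, hBeq]
    · have h := mgf_sum_importance_weighted_le t F O hO q hqcond hqmeas v hv hlow r hr l
        fun s hs => (mul_le_mul_of_nonneg_left (hvR s hs) (abs_nonneg l)).trans hl
      exact ⟨h.1, h.2.trans
        (Real.exp_le_exp.2 (mul_le_mul_of_nonneg_left hvW (sq_nonneg l)))⟩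
  set G : Set Ω := {ω | |(1 / (t : ℝ)) * ∑ s ∈ Finset.Icc 1 t,
      r s * (O s).indicator (fun _ => (1 : ℝ)) ω / q s ω
      - (1 / (t : ℝ)) * ∑ s ∈ Finset.Icc 1 t, r s| ≤ Real.sqrt B} with hG
  have hcover : Set.univ ⊆ G ∪ {ω | t * Real.sqrt B ≤ |S ω|} := by
    intro ω _
    rcases le_total (|S ω|) (t * Real.sqrt B) with h | h
    · left
      rw [hG, Set.mem_ofPred_eq, ← mul_sub, ← Finset.sum_sub_distrib, abs_mul,
        abs_of_pos (by positivity), one_div, inv_mul_le_iff₀ ht0]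
      exact h
    · exact Or.inr h
  have h1 : (1 : ℝ) ≤ μ.real G + 2 * δ := by
    calc (1 : ℝ) = μ.real Set.univ := probReal_univ.symm
      _ ≤ μ.real (G ∪ {ω | t * Real.sqrt B ≤ |S ω|}) := measureReal_mono hcover
      _ ≤ μ.real G + μ.real {ω | t * Real.sqrt B ≤ |S ω|} := measureReal_union_le _ _
      _ ≤ μ.real G + 2 * δ := by linarith
  exact (ENNReal.ofReal_le_iff_le_toReal (measure_ne_top μ G)).2
    (show 1 - 2 * δ ≤ μ.real G by linarith)
end

section
/- Let (F_s)_{s=0}^t be a filtration, and for each round s = 1,...,t let O_s be an F_s-measurable event ('arm i is observed at round s') whose conditional probability q_s = P(O_s | F_{s-1}) is F_{s-1}-measurable and almost surely satisfies q_s ≥ γ_s/D for s ≤ min(t, τ') and q_s ≥ γ_s τ'/(D s) for τ' < s ≤ t. Let R_1, ..., R_t be random rewards with R_s ∈ [0,1], R_s F_s-measurable, E[R_s | F_{s-1}] = μ almost surely, and R_s conditionally independent of O_s given F_{s-1}. Define r̃_s = R_s · 1[O_s] / q_s. Then for every δ ∈ (0,1), with probability at least 1 − 2δ, |(1/t) Σ_{s=1}^t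 r̃_s − μ| ≤ Radius_t, where Radius_t = sqrt( 4 ( (D/t²) Σ_{s=1}^{min(t,τ')} 1/γ_s + D·max(t − τ', 0)/(γ_t τ' t) ) log(t/δ) + (5 D² / (γ_t² · min(t,τ')²)) log²(t/δ) ). -/
open MeasureTheory Finset ProbabilityTheory

/-- Conditional expectation of a product of conditionally independent integrable functions. -/
theorem ProbabilityTheory.CondIndepFun.condExp_mul {Ω : Type*} {m' m : MeasurableSpace Ω}
    [StandardBorelSpace Ω] {hm' : m' ≤ m} {μ : Measure Ω} [IsFiniteMeasure μ] {f g : Ω → ℝ}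
    (h : CondIndepFun m' hm' f g μ) (hf : Measurable f) (hg : Measurable g)
    (hfi : Integrable f μ) (hgi : Integrable g μ) (hfgi : Integrable (f * g) μ) :
    μ[f * g | m'] =ᵐ[μ] μ[f | m'] * μ[g | m'] := by
  have hker := ae_of_ae_trim hm' ((condIndepFun_iff_map_prod_eq_prod_map_map hf hg).1 h)
  filter_upwards [hker, condExp_ae_eq_integral_condExpKernel hm' hfi,
    condExp_ae_eq_integral_condExpKernel hm' hgi,
    condExp_ae_eq_integral_condExpKernel hm' hfgi] with ω hω h1 h2 h3
  have hind : IndepFun f g (condExpKernel μ m' ω) := by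
    rw [indepFun_iff_map_prod_eq_prod_map_map hf.aemeasurable hg.aemeasurable]
    rw [Kernel.map_apply _ (hf.prodMk hg), Kernel.prod_apply, Kernel.map_apply _ hf,
      Kernel.map_apply _ hg] at hω
    exact hω
  rw [h3, Pi.mul_apply, h1, h2]
  exact hind.integral_mul_eq_mul_integral hf.aestronglyMeasurable hg.aestronglyMeasurable

/-- One step of the exponential supermartingale argument for a conditionally centred increment
with conditional second moment at most `v`. -/
theorem integral_mul_exp_le_s3 {Ω : Type*} {m' m : MeasurableSpace Ω} (hm' : m' ≤ m) {μ : Measure Ω}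
    [IsProbabilityMeasure μ] {g X : Ω → ℝ} {v l C b : ℝ} (hg : StronglyMeasurable[m'] g)
    (hg0 : ∀ ω, 0 ≤ g ω) (hgC : ∀ᵐ ω ∂μ, g ω ≤ C)
    (hX : StronglyMeasurable X) (hXb : ∀ᵐ ω ∂μ, |X ω| ≤ b) (hl : |l| * b ≤ 1)
    (hmean : μ[X | m'] =ᵐ[μ] 0) (hvar : μ[fun ω => X ω ^ 2 | m'] ≤ᵐ[μ] fun _ => v) :
    ∫ ω, g ω * Real.exp (l * X ω) ∂μ ≤ Real.exp (l ^ 2 * v) * ∫ ω, g ω ∂μ := by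
  have hgb : ∀ᵐ ω ∂μ, ‖g ω‖ ≤ C := by
    filter_upwards [hgC] with ω h
    rwa [Real.norm_eq_abs, abs_of_nonneg (hg0 ω)]
  have hgm : AEStronglyMeasurable g μ := (hg.mono hm').aestronglyMeasurable
  have hgi : Integrable g μ := .of_bound hgm C hgb
  have hXi : Integrable X μ := .of_bound hX.aestronglyMeasurable b hXb
  have hX2i : Integrable (fun ω => X ω ^ 2) μ := by
    refine .of_bound (hX.pow 2).aestronglyMeasurable (b ^ 2) ?_
    filter_upwards [hXb] with ω h
    rw [Real.norm_eq_abs, abs_pow]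
    gcongr
  have hei : Integrable (fun ω => Real.exp (l * X ω)) μ := by
    refine .of_bound (Real.continuous_exp.comp_stronglyMeasurable
      (hX.const_mul l)).aestronglyMeasurable (Real.exp 1) ?_
    filter_upwards [hXb] with ω h
    rw [Real.norm_eq_abs, Real.abs_exp, Real.exp_le_exp]
    calc l * X ω ≤ |l * X ω| := le_abs_self _
      _ = |l| * |X ω| := abs_mul _ _
      _ ≤ |l| * b := by gcongr
      _ ≤ 1 := hl
  have hgXi : Integrable (g * X) μ := hXi.bdd_mul hgm hgb
  have hgX2i : Integrable (g * fun ω => X ω ^ 2) μ := hX2i.bdd_mul hgm hgb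
  have h1 : ∫ ω, (g * X) ω ∂μ = 0 := by
    rw [← integral_condExp hm']
    refine integral_eq_zero_of_ae ?_
    filter_upwards [condExp_stronglyMeasurable_mul_of_bound hm' hg hXi C hgb, hmean] with ω h h'
    simp [h, h']
  have h2 : ∫ ω, (g * fun ω => X ω ^ 2) ω ∂μ ≤ v * ∫ ω, g ω ∂μ := by
    rw [← integral_condExp hm', ← integral_const_mul]
    refine integral_mono_ae integrable_condExp (hgi.const_mul v) ?_
    filter_upwards [condExp_stronglyMeasurable_mul_of_bound hm' hg hX2i C hgb, hvar] with ω h h'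
    rw [h, Pi.mul_apply, mul_comm]
    exact mul_le_mul_of_nonneg_right h' (hg0 ω)
  calc ∫ ω, g ω * Real.exp (l * X ω) ∂μ
      ≤ ∫ ω, (g ω + l * (g * X) ω) + l ^ 2 * (g * fun ω => X ω ^ 2) ω ∂μ := by
        refine integral_mono_ae (hei.bdd_mul hgm hgb)
          ((hgi.add (hgXi.const_mul l)).add (hgX2i.const_mul _)) ?_
        filter_upwards [hXb] with ω h
        have hlX : |l * X ω| ≤ 1 := by
          rw [abs_mul]
          exact (mul_le_mul_of_nonneg_left h (abs_nonneg l)).trans hl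
        have := (abs_le.1 (Real.abs_exp_sub_one_sub_id_le hlX)).2
        have := mul_le_mul_of_nonneg_left this (hg0 ω)
        simp only [Pi.mul_apply]
        linarith
    _ = ∫ ω, g ω ∂μ + l ^ 2 * ∫ ω, (g * fun ω => X ω ^ 2) ω ∂μ := by
        rw [integral_add (f := fun ω => g ω + l * (g * X) ω) (hgi.add (hgXi.const_mul l))
            (hgX2i.const_mul _),
          integral_add hgi (hgXi.const_mul l), integral_const_mul, integral_const_mul, h1]
        ring
    _ ≤ (l ^ 2 * v + 1) * ∫ ω, g ω ∂μ := by
        have := mul_le_mul_of_nonneg_left h2 (sq_nonneg l)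
        linarith
    _ ≤ Real.exp (l ^ 2 * v) * ∫ ω, g ω ∂μ :=
        mul_le_mul_of_nonneg_right (Real.add_one_le_exp _) (integral_nonneg hg0)

section Freedman

variable {Ω : Type*} {m : MeasurableSpace Ω} {μ : Measure Ω} {F : Filtration ℕ m}
  {X : ℕ → Ω → ℝ} {v : ℕ → ℝ} {b : ℝ} {t : ℕ}

theorem stronglyMeasurable_sum_Icc_of_adapted
    (hX : ∀ s ∈ Finset.Icc 1 t, StronglyMeasurable[F s] (X s)) :
    StronglyMeasurable[F t] (fun ω => ∑ s ∈ Finset.Icc 1 t, X s ω) :=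
  Finset.stronglyMeasurable_fun_sum _ fun s hs =>
    (hX s hs).mono (F.mono (Finset.mem_Icc.1 hs).2)

theorem ae_exp_mul_sum_le (hXb : ∀ s ∈ Finset.Icc 1 t, ∀ᵐ ω ∂μ, |X s ω| ≤ b) (l : ℝ) :
    ∀ᵐ ω ∂μ, Real.exp (l * ∑ s ∈ Finset.Icc 1 t, X s ω) ≤ Real.exp (|l| * (t * b)) := by
  filter_upwards [(ae_ball_iff (Finset.Icc 1 t).countable_toSet).2 hXb] with ω h
  rw [Real.exp_le_exp]
  calc l * ∑ s ∈ Finset.Icc 1 t, X s ω ≤ |l| * |∑ s ∈ Finset.Icc 1 t, X s ω| := by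
        rw [← abs_mul]; exact le_abs_self _
    _ ≤ |l| * ∑ s ∈ Finset.Icc 1 t, |X s ω| := by
        gcongr; exact Finset.abs_sum_le_sum_abs _ _
    _ ≤ |l| * (t * b) := by
        gcongr
        simpa using Finset.sum_le_card_nsmul _ _ b h

/-- Bound on the moment generating function of a sum of bounded martingale differences. -/
theorem integral_exp_mul_sum_le [IsProbabilityMeasure μ] {l : ℝ} (hl : |l| * b ≤ 1)
    (hX : ∀ s ∈ Finset.Icc 1 t, StronglyMeasurable[F s] (X s))
    (hXb : ∀ s ∈ Finset.Icc 1 t, ∀ᵐ ω ∂μ, |X s ω| ≤ b)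
    (hmean : ∀ s ∈ Finset.Icc 1 t, μ[X s | F (s - 1)] =ᵐ[μ] 0)
    (hvar : ∀ s ∈ Finset.Icc 1 t,
      μ[fun ω => X s ω ^ 2 | F (s - 1)] ≤ᵐ[μ] fun _ => v s) :
    ∫ ω, Real.exp (l * ∑ s ∈ Finset.Icc 1 t, X s ω) ∂μ
      ≤ Real.exp (l ^ 2 * ∑ s ∈ Finset.Icc 1 t, v s) := by
  induction t with
  | zero => simp
  | succ n ih =>
    have hsub : Finset.Icc 1 n ⊆ Finset.Icc 1 (n + 1) := Finset.Icc_subset_Icc_right n.le_succ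
    have hn : n + 1 ∈ Finset.Icc 1 (n + 1) := by simp
    have ih := ih (fun s hs => hX s (hsub hs)) (fun s hs => hXb s (hsub hs))
      (fun s hs => hmean s (hsub hs)) (fun s hs => hvar s (hsub hs))
    have hg : StronglyMeasurable[F n]
        (fun ω => Real.exp (l * ∑ s ∈ Finset.Icc 1 n, X s ω)) :=
      Real.continuous_exp.comp_stronglyMeasurable
        ((stronglyMeasurable_sum_Icc_of_adapted fun s hs => hX s (hsub hs)).const_mul l)
    have step := integral_mul_exp_le_s3 (F.le n) hg (fun ω => (Real.exp_pos _).le)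
      (ae_exp_mul_sum_le (fun s hs => hXb s (hsub hs)) l) ((hX _ hn).mono (F.le _)) (hXb _ hn) hl
      (hmean _ hn) (hvar _ hn)
    simp_rw [Finset.sum_Icc_succ_top (Nat.le_add_left 1 n), mul_add, Real.exp_add]
    calc _ ≤ _ := step
      _ ≤ _ := mul_le_mul_of_nonneg_left ih (Real.exp_pos _).le
      _ = _ := mul_comm _ _

/-- A Freedman-type inequality for bounded martingale differences whose conditional variances are
bounded by constants. -/
theorem measureReal_sum_ge_le_exp_neg [IsProbabilityMeasure μ] {V L e : ℝ}
    (hb : 0 < b) (hV : 0 < V) (hL : 0 ≤ L) (he : 0 ≤ e) (heL : 4 * V * L + 5 * b ^ 2 * L ^ 2 ≤ e ^ 2)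
    (hvV : ∑ s ∈ Finset.Icc 1 t, v s ≤ V)
    (hX : ∀ s ∈ Finset.Icc 1 t, StronglyMeasurable[F s] (X s))
    (hXb : ∀ s ∈ Finset.Icc 1 t, ∀ᵐ ω ∂μ, |X s ω| ≤ b)
    (hmean : ∀ s ∈ Finset.Icc 1 t, μ[X s | F (s - 1)] =ᵐ[μ] 0)
    (hvar : ∀ s ∈ Finset.Icc 1 t,
      μ[fun ω => X s ω ^ 2 | F (s - 1)] ≤ᵐ[μ] fun _ => v s) :
    μ.real {ω | e ≤ ∑ s ∈ Finset.Icc 1 t, X s ω} ≤ Real.exp (-L) := by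
  have chernoff : ∀ l : ℝ, 0 ≤ l → l * b ≤ 1 → l ^ 2 * V + L ≤ l * e →
      μ.real {ω | e ≤ ∑ s ∈ Finset.Icc 1 t, X s ω} ≤ Real.exp (-L) := by
    intro l hl0 hlb hlL
    have hlb' : |l| * b ≤ 1 := by rwa [abs_of_nonneg hl0]
    have hint : Integrable (fun ω => Real.exp (l * ∑ s ∈ Finset.Icc 1 t, X s ω)) μ := by
      refine .of_bound (Real.continuous_exp.comp_stronglyMeasurable
        (((stronglyMeasurable_sum_Icc_of_adapted hX).mono
          (F.le t)).const_mul l)).aestronglyMeasurable (Real.exp (|l| * (t * b))) ?_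
      filter_upwards [ae_exp_mul_sum_le hXb l] with ω h
      rwa [Real.norm_eq_abs, Real.abs_exp]
    calc _ ≤ Real.exp (-l * e) * mgf (fun ω => ∑ s ∈ Finset.Icc 1 t, X s ω) μ l :=
          measure_ge_le_exp_mul_mgf e hl0 hint
      _ ≤ Real.exp (-l * e) * Real.exp (l ^ 2 * ∑ s ∈ Finset.Icc 1 t, v s) := by
          gcongr
          exact integral_exp_mul_sum_le hlb' hX hXb hmean hvar
      _ ≤ Real.exp (-L) := by
          rw [← Real.exp_add, Real.exp_le_exp]
          have := mul_le_mul_of_nonneg_left hvV (sq_nonneg l)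
          linarith
  rcases le_total (e * b) (2 * V) with h | h
  · refine chernoff (e / (2 * V)) (by positivity) ?_ ?_
    · rw [div_mul_eq_mul_div]
      exact div_le_one_of_le₀ h (by positivity)
    · have hLe : L ≤ e ^ 2 / (4 * V) := by
        rw [le_div_iff₀ (by positivity)]
        nlinarith [mul_nonneg (sq_nonneg b) (sq_nonneg L)]
      have h1 : (e / (2 * V)) ^ 2 * V = e ^ 2 / (4 * V) := by field_simp; norm_num
      have h2 : e / (2 * V) * e = e ^ 2 / (4 * V) + e ^ 2 / (4 * V) := by field_simp; ring
      linarith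
  · refine chernoff (1 / b) (by positivity) (by field_simp; rfl) ?_
    have h2 : 2 * (b * L) ≤ e := by
      refine le_of_sq_le_sq ?_ he
      nlinarith [mul_nonneg hV.le hL, mul_nonneg (sq_nonneg b) (sq_nonneg L)]
    rw [show (1 / b) ^ 2 * V + L = (V + b * (b * L)) / b ^ 2 by field_simp,
      show 1 / b * e = e * b / b ^ 2 by field_simp]
    gcongr
    nlinarith

end Freedman

section InverseWeighting

variable {Ω : Type*} {m' m : MeasurableSpace Ω} {μ : Measure Ω} {A : Set Ω}
  {R q : Ω → ℝ} {μ₀ c : ℝ}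

theorem one_le_one_div_of_le_condExp_indicator [IsProbabilityMeasure μ] (hm' : m' ≤ m)
    (hc : 0 < c) (hA : MeasurableSet A) (hq : q =ᵐ[μ] μ[A.indicator (fun _ => (1 : ℝ)) | m'])
    (hcq : ∀ᵐ ω ∂μ, c ≤ q ω) :
    1 ≤ 1 / c := by
  have h1 : μ[A.indicator (fun _ => (1 : ℝ)) | m'] ≤ᵐ[μ] fun _ => 1 := by
    have := condExp_mono (m := m') ((integrable_const (1 : ℝ)).indicator hA)
      (integrable_const (1 : ℝ))
      (ae_of_all μ fun ω => Set.indicator_le_self' (fun _ _ => zero_le_one) ω)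
    rwa [condExp_const hm'] at this
  obtain ⟨ω, h, h', h''⟩ := (hq.and (h1.and hcq)).exists
  rw [le_div_iff₀ hc, one_mul]
  exact h''.trans (h.le.trans h')

theorem ae_abs_inverseWeighted_sub_le (hc : 0 < c) (hc1 : 1 ≤ 1 / c)
    (hcq : ∀ᵐ ω ∂μ, c ≤ q ω) (hR : ∀ᵐ ω ∂μ, R ω ∈ Set.Icc (0 : ℝ) 1)
    (hμ₀ : μ₀ ∈ Set.Icc (0 : ℝ) 1) :
    ∀ᵐ ω ∂μ, (0 ≤ R ω * A.indicator (fun _ => (1 : ℝ)) ω / q ω ∧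
      R ω * A.indicator (fun _ => (1 : ℝ)) ω / q ω ≤ 1 / c) ∧
      |R ω * A.indicator (fun _ => (1 : ℝ)) ω / q ω - μ₀| ≤ 1 / c := by
  filter_upwards [hcq, hR] with ω hω hRω
  have hq0 : 0 < q ω := hc.trans_le hω
  have hi : 0 ≤ A.indicator (fun _ => (1 : ℝ)) ω ∧ A.indicator (fun _ => (1 : ℝ)) ω ≤ 1 := by
    by_cases h : ω ∈ A <;> simp [h]
  have h0 : 0 ≤ R ω * A.indicator (fun _ => (1 : ℝ)) ω / q ω :=
    div_nonneg (mul_nonneg hRω.1 hi.1) hq0.le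
  have h1 : R ω * A.indicator (fun _ => (1 : ℝ)) ω / q ω ≤ 1 / c :=
    div_le_div₀ zero_le_one (mul_le_one₀ hRω.2 hi.1 hi.2) hc hω
  exact ⟨⟨h0, h1⟩, abs_le.2 ⟨by linarith [hμ₀.2], by linarith [hμ₀.1]⟩⟩

theorem condExp_inverseWeighted_sub_eq_zero [StandardBorelSpace Ω] [IsProbabilityMeasure μ]
    {hm' : m' ≤ m} (hc : 0 < c) (hA : MeasurableSet A)
    (hq : q =ᵐ[μ] μ[A.indicator (fun _ => (1 : ℝ)) | m']) (hqm : StronglyMeasurable[m'] q)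
    (hcq : ∀ᵐ ω ∂μ, c ≤ q ω) (hRm : StronglyMeasurable R)
    (hR : ∀ᵐ ω ∂μ, R ω ∈ Set.Icc (0 : ℝ) 1) (hmean : μ[R | m'] =ᵐ[μ] fun _ => μ₀)
    (hind : CondIndepFun m' hm' R (A.indicator (fun _ => (1 : ℝ))) μ) :
    μ[fun ω => R ω * A.indicator (fun _ => (1 : ℝ)) ω / q ω - μ₀ | m'] =ᵐ[μ] 0 := by
  have hIm : Measurable (A.indicator (fun _ => (1 : ℝ))) := measurable_const.indicator hA
  have hRi : Integrable R μ := by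
    refine .of_bound hRm.aestronglyMeasurable 1 ?_
    filter_upwards [hR] with ω h
    rw [Real.norm_eq_abs, abs_of_nonneg h.1]
    exact h.2
  have hIi : Integrable (A.indicator (fun _ => (1 : ℝ))) μ := (integrable_const _).indicator hA
  have hRb : ∀ᵐ ω ∂μ, ‖R ω‖ ≤ 1 := by
    filter_upwards [hR] with ω h
    rw [Real.norm_eq_abs, abs_of_nonneg h.1]
    exact h.2
  have hRIi : Integrable (R * A.indicator (fun _ => (1 : ℝ))) μ :=
    hIi.bdd_mul hRm.aestronglyMeasurable hRb
  have hqb : ∀ᵐ ω ∂μ, ‖(q ω)⁻¹‖ ≤ c⁻¹ := by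
    filter_upwards [hcq] with ω h
    rw [Real.norm_eq_abs, abs_of_pos (inv_pos.2 (hc.trans_le h))]
    exact inv_anti₀ hc h
  have hqim : StronglyMeasurable[m'] (fun ω => (q ω)⁻¹) :=
    (hqm.measurable.inv).stronglyMeasurable
  have hwi : Integrable ((fun ω => (q ω)⁻¹) * (R * A.indicator (fun _ => (1 : ℝ)))) μ :=
    hRIi.bdd_mul (hqim.mono hm').aestronglyMeasurable hqb
  have heq : (fun ω => R ω * A.indicator (fun _ => (1 : ℝ)) ω / q ω - μ₀)
      = (fun ω => (q ω)⁻¹) * (R * A.indicator (fun _ => (1 : ℝ))) - fun _ => μ₀ := by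
    ext ω
    simp only [Pi.sub_apply, Pi.mul_apply]
    rw [div_eq_inv_mul]
  rw [heq]
  filter_upwards [condExp_sub hwi (integrable_const μ₀) m',
    condExp_stronglyMeasurable_mul_of_bound hm' hqim hRIi _ hqb,
    hind.condExp_mul hRm.measurable hIm hRi hIi hRIi, hq, hmean, hcq] with ω h1 h2 h3 h4 h5 h6
  have hq0 : q ω ≠ 0 := (hc.trans_le h6).ne'
  rw [h1, Pi.sub_apply, h2, Pi.mul_apply, h3, Pi.mul_apply, ← h4, h5, condExp_const hm']
  simp only [Pi.zero_apply]
  field_simp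
  ring

theorem condExp_sq_inverseWeighted_sub_le [IsProbabilityMeasure μ] (hm' : m' ≤ m)
    (hc : 0 < c) (hc1 : 1 ≤ 1 / c) (hA : MeasurableSet A) (hqm : StronglyMeasurable[m'] q)
    (hcq : ∀ᵐ ω ∂μ, c ≤ q ω) (hRm : StronglyMeasurable R)
    (hR : ∀ᵐ ω ∂μ, R ω ∈ Set.Icc (0 : ℝ) 1) (hμ₀ : μ₀ ∈ Set.Icc (0 : ℝ) 1)
    (hmean : μ[fun ω => R ω * A.indicator (fun _ => (1 : ℝ)) ω / q ω - μ₀ | m'] =ᵐ[μ] 0) :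
    μ[fun ω => (R ω * A.indicator (fun _ => (1 : ℝ)) ω / q ω - μ₀) ^ 2 | m']
      ≤ᵐ[μ] fun _ => 1 / c := by
  have hbd := ae_abs_inverseWeighted_sub_le (A := A) hc hc1 hcq hR hμ₀
  set X : Ω → ℝ := fun ω => R ω * A.indicator (fun _ => (1 : ℝ)) ω / q ω - μ₀ with hXdef
  have hXm : StronglyMeasurable X :=
    ((hRm.measurable.mul (measurable_const.indicator hA)).div
      (hqm.mono hm').measurable).stronglyMeasurable.sub stronglyMeasurable_const
  have hXi : Integrable X μ :=
    .of_bound hXm.aestronglyMeasurable (1 / c) (hbd.mono fun ω h => h.2)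
  have hX2i : Integrable (fun ω => X ω ^ 2) μ := by
    refine .of_bound (hXm.pow 2).aestronglyMeasurable ((1 / c) ^ 2) ?_
    filter_upwards [hbd] with ω h
    rw [Real.norm_eq_abs, abs_pow]
    gcongr
    exact h.2
  have hle : (fun ω => X ω ^ 2) ≤ᵐ[μ] (1 / c - 2 * μ₀) • X + fun _ => μ₀ * (1 / c) - μ₀ ^ 2 := by
    filter_upwards [hbd] with ω h
    have := mul_le_mul_of_nonneg_left h.1.2 h.1.1
    simp only [Pi.add_apply, Pi.smul_apply, smul_eq_mul, hXdef]
    nlinarith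
  filter_upwards [condExp_mono hX2i ((hXi.smul _).add (integrable_const _)) hle,
    condExp_add (hXi.smul (1 / c - 2 * μ₀)) (integrable_const (μ₀ * (1 / c) - μ₀ ^ 2)) m',
    condExp_smul (1 / c - 2 * μ₀) X m' (μ := μ), hmean] with ω h1 h2 h3 h4
  refine h1.trans ?_
  rw [h2, Pi.add_apply, h3, Pi.smul_apply, h4, condExp_const hm']
  simp only [Pi.zero_apply, smul_zero, zero_add]
  nlinarith [hμ₀.1, hμ₀.2, sq_nonneg μ₀]

end InverseWeighting

/-- Sum over the rounds of the bounds on the inverse observation probabilities. -/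
theorem sum_one_div_ite_le {t τ' : ℕ} (ht : 1 ≤ t) (hτ' : 1 ≤ τ') {D : ℝ} (hD : 0 < D)
    {γ : ℕ → ℝ} (hγpos : ∀ s ∈ Finset.Icc 1 t, 0 < γ s)
    (hγmono : ∀ s ∈ Finset.Icc 1 t, ∀ s' ∈ Finset.Icc 1 t, s ≤ s' → γ s' ≤ γ s) :
    ∑ s ∈ Finset.Icc 1 t, 1 / (if s ≤ τ' then γ s / D else γ s * (τ' : ℝ) / (D * s)) ≤
      (t : ℝ) ^ 2 * ((D / (t : ℝ) ^ 2) * (∑ s ∈ Finset.Icc 1 (min t τ'), 1 / γ s)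
        + D * max ((t : ℝ) - (τ' : ℝ)) 0 / (γ t * (τ' : ℝ) * (t : ℝ))) := by
  have htmem : t ∈ Finset.Icc 1 t := Finset.mem_Icc.2 ⟨ht, le_rfl⟩
  have htR : (0 : ℝ) < t := by exact_mod_cast ht
  have hτR : (0 : ℝ) < τ' := by exact_mod_cast hτ'
  have hγt := hγpos t htmem
  rw [← Finset.sum_filter_add_sum_filter_not _ (fun s => s ≤ τ'), mul_add]
  gcongr ?_ + ?_
  · have hf : (Finset.Icc 1 t).filter (fun s => s ≤ τ') = Finset.Icc 1 (min t τ') := by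
      ext s; simp only [Finset.mem_filter, Finset.mem_Icc]; omega
    rw [hf, ← mul_assoc, mul_div_cancel₀ _ (by positivity), Finset.mul_sum]
    refine Finset.sum_le_sum fun s hs => ?_
    rw [if_pos ((Finset.mem_Icc.1 hs).2.trans (min_le_right _ _)), one_div_div, mul_one_div]
  · have hf : (Finset.Icc 1 t).filter (fun s => ¬ s ≤ τ') = Finset.Icc (τ' + 1) t := by
      ext s; simp only [Finset.mem_filter, Finset.mem_Icc]; omega
    rw [hf]
    have hterm : ∀ s ∈ Finset.Icc (τ' + 1) t,
        1 / (if s ≤ τ' then γ s / D else γ s * (τ' : ℝ) / (D * s)) ≤ D * t / (γ t * τ') := by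
      intro s hs
      obtain ⟨h1, h2⟩ := Finset.mem_Icc.1 hs
      have hsmem : s ∈ Finset.Icc 1 t := Finset.mem_Icc.2 ⟨by omega, h2⟩
      rw [if_neg (by omega), one_div_div]
      have := hγmono s hsmem t htmem h2
      gcongr
    refine (Finset.sum_le_card_nsmul _ _ _ hterm).trans ?_
    have hcard : ((t + 1 - (τ' + 1) : ℕ) : ℝ) ≤ max ((t : ℝ) - (τ' : ℝ)) 0 := by
      rw [Nat.add_sub_add_right]
      rcases le_total τ' t with h | h
      · rw [Nat.cast_sub h]; exact le_max_left _ _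
      · rw [Nat.sub_eq_zero_of_le h, Nat.cast_zero]; exact le_max_right _ _
    rw [Nat.card_Icc, nsmul_eq_mul]
    refine (mul_le_mul_of_nonneg_right hcard (by positivity)).trans_eq ?_
    field_simp

/-- Uniform bound on the inverse observation probabilities. -/
theorem one_div_ite_le {t τ' s : ℕ} (hs : s ∈ Finset.Icc 1 t) (hτ' : 1 ≤ τ') {D : ℝ} (hD : 0 < D)
    {γ : ℕ → ℝ} (hγpos : 0 < γ t) (hγ : γ t ≤ γ s) :
    1 / (if s ≤ τ' then γ s / D else γ s * (τ' : ℝ) / (D * s)) ≤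
      t * (D / (γ t * ((min t τ' : ℕ) : ℝ))) := by
  obtain ⟨hs1, hst⟩ := Finset.mem_Icc.1 hs
  have hmR : (0 : ℝ) < ((min t τ' : ℕ) : ℝ) := by
    exact_mod_cast lt_min (hs1.trans hst) hτ'
  have hmt : ((min t τ' : ℕ) : ℝ) ≤ t := by exact_mod_cast min_le_left t τ'
  split_ifs with h
  · rw [one_div_div]
    calc D / γ s ≤ D / γ t := by gcongr
      _ = ((min t τ' : ℕ) : ℝ) * (D / (γ t * ((min t τ' : ℕ) : ℝ))) := by field_simp
      _ ≤ t * (D / (γ t * ((min t τ' : ℕ) : ℝ))) := by gcongr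
  · rw [one_div_div, min_eq_right (by omega)]
    have hτR : (0 : ℝ) < τ' := by exact_mod_cast hτ'
    calc D * s / (γ s * τ') ≤ D * t / (γ t * τ') := by gcongr
      _ = t * (D / (γ t * τ')) := by ring

/-- Stochastic-setting half of the concentration lemma: the importance-weighted
running average `(1/t) ∑ r̃_s` concentrates around the true mean reward `μ₀`
within the confidence radius `Radius_t`, with probability at least `1 - 2δ`.
Here `τ' : ℕ` with `τ' ≥ 1`; any `τ' > t` plays the role of `τ' = ∞` (the second
variance summand then vanishes since `max (t - τ') 0 = 0`). -/
theorem stmt_3 {Ω : Type*} {m : MeasurableSpace Ω} [StandardBorelSpace Ω]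
    [Nonempty Ω] {μ : Measure Ω} [IsProbabilityMeasure μ]
    (t : ℕ) (ht : 1 ≤ t) (F : Filtration ℕ m)
    (O : ℕ → Set Ω) (hO : ∀ s ∈ Finset.Icc 1 t, MeasurableSet[F s] (O s))
    (q : ℕ → Ω → ℝ)
    (hqcond : ∀ s ∈ Finset.Icc 1 t,
      q s =ᵐ[μ] μ[(O s).indicator (fun _ => (1 : ℝ)) | F (s - 1)])
    (hqmeas : ∀ s ∈ Finset.Icc 1 t, StronglyMeasurable[F (s - 1)] (q s))
    (D : ℝ) (hD : 1 ≤ D)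
    (γ : ℕ → ℝ) (hγpos : ∀ s ∈ Finset.Icc 1 t, 0 < γ s)
    (hγmono : ∀ s ∈ Finset.Icc 1 t, ∀ s' ∈ Finset.Icc 1 t, s ≤ s' → γ s' ≤ γ s)
    (τ' : ℕ) (hτ' : 1 ≤ τ')
    (hlow1 : ∀ s ∈ Finset.Icc 1 (min t τ'), ∀ᵐ ω ∂μ, γ s / D ≤ q s ω)
    (hlow2 : ∀ s ∈ Finset.Icc (τ' + 1) t,
      ∀ᵐ ω ∂μ, γ s * (τ' : ℝ) / (D * s) ≤ q s ω)
    (R : ℕ → Ω → ℝ) (μ₀ : ℝ) (hμ₀ : μ₀ ∈ Set.Icc (0 : ℝ) 1)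
    (hRrange : ∀ s ∈ Finset.Icc 1 t, ∀ᵐ ω ∂μ, R s ω ∈ Set.Icc (0 : ℝ) 1)
    (hRmeas : ∀ s ∈ Finset.Icc 1 t, StronglyMeasurable[F s] (R s))
    (hRmean : ∀ s ∈ Finset.Icc 1 t, μ[R s | F (s - 1)] =ᵐ[μ] fun _ => μ₀)
    (hRindep : ∀ s ∈ Finset.Icc 1 t,
      CondIndepFun (F (s - 1)) (F.le (s - 1)) (R s)
        ((O s).indicator (fun _ => (1 : ℝ))) μ)
    (δ : ℝ) (hδ0 : 0 < δ) (hδ1 : δ < 1) :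
    ENNReal.ofReal (1 - 2 * δ) ≤
      μ {ω | |(1 / (t : ℝ)) * ∑ s ∈ Finset.Icc 1 t,
            R s ω * (O s).indicator (fun _ => (1 : ℝ)) ω / q s ω - μ₀| ≤
        Real.sqrt (4 * ((D / (t : ℝ) ^ 2) *
              (∑ s ∈ Finset.Icc 1 (min t τ'), 1 / γ s)
            + D * max ((t : ℝ) - (τ' : ℝ)) 0 / (γ t * (τ' : ℝ) * (t : ℝ)))
            * Real.log ((t : ℝ) / δ)
          + (5 * D ^ 2 / (γ t ^ 2 * ((min t τ' : ℕ) : ℝ) ^ 2))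
            * Real.log ((t : ℝ) / δ) ^ 2)} := by
  have hD0 : 0 < D := one_pos.trans_le hD
  have htmem : t ∈ Finset.Icc 1 t := Finset.mem_Icc.2 ⟨ht, le_rfl⟩
  have htR : (0 : ℝ) < t := by exact_mod_cast ht
  have hγt := hγpos t htmem
  have hmR : (0 : ℝ) < ((min t τ' : ℕ) : ℝ) := by exact_mod_cast lt_min ht hτ'
  set L := Real.log ((t : ℝ) / δ) with hLdef
  set c : ℕ → ℝ := fun s => if s ≤ τ' then γ s / D else γ s * (τ' : ℝ) / (D * s) with hcdef
  set X : ℕ → Ω → ℝ := fun s ω => R s ω * (O s).indicator (fun _ => (1 : ℝ)) ω / q s ω - μ₀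
    with hXdef
  set A := (D / (t : ℝ) ^ 2) * (∑ s ∈ Finset.Icc 1 (min t τ'), 1 / γ s)
            + D * max ((t : ℝ) - (τ' : ℝ)) 0 / (γ t * (τ' : ℝ) * (t : ℝ))
  set B := D / (γ t * ((min t τ' : ℕ) : ℝ)) with hBdef
  have hBsq : 5 * D ^ 2 / (γ t ^ 2 * ((min t τ' : ℕ) : ℝ) ^ 2) = 5 * B ^ 2 := by
    rw [hBdef, div_pow, mul_pow, mul_div_assoc]
  rw [hBsq]
  set rad := Real.sqrt (4 * A * L + 5 * B ^ 2 * L ^ 2) with hraddef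
  have hB : 0 < B := by positivity
  have hc : ∀ s ∈ Finset.Icc 1 t, 0 < c s := by
    intro s hs
    have h1 := hγpos s hs
    have h2 : (0 : ℝ) < s := by exact_mod_cast (Finset.mem_Icc.1 hs).1
    simp only [hcdef]
    split_ifs <;> positivity
  have hcq : ∀ s ∈ Finset.Icc 1 t, ∀ᵐ ω ∂μ, c s ≤ q s ω := by
    intro s hs
    obtain ⟨hs1, hst⟩ := Finset.mem_Icc.1 hs
    simp only [hcdef]
    split_ifs with h
    · exact hlow1 s (Finset.mem_Icc.2 ⟨hs1, le_min hst h⟩)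
    · exact hlow2 s (Finset.mem_Icc.2 ⟨by omega, hst⟩)
  have hOm : ∀ s ∈ Finset.Icc 1 t, MeasurableSet (O s) := fun s hs => F.le s _ (hO s hs)
  have hRm : ∀ s ∈ Finset.Icc 1 t, StronglyMeasurable (R s) := fun s hs =>
    (hRmeas s hs).mono (F.le s)
  have hc1 : ∀ s ∈ Finset.Icc 1 t, 1 ≤ 1 / c s := fun s hs =>
    one_le_one_div_of_le_condExp_indicator (F.le (s - 1)) (hc s hs) (hOm s hs) (hqcond s hs)
      (hcq s hs)
  have hX : ∀ s ∈ Finset.Icc 1 t, StronglyMeasurable[F s] (X s) := by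
    intro s hs
    have h1 : Measurable[F s] ((O s).indicator (fun _ => (1 : ℝ))) :=
      measurable_const.indicator (hO s hs)
    have h2 : Measurable[F s] (q s) := ((hqmeas s hs).mono (F.mono (Nat.sub_le s 1))).measurable
    exact ((((hRmeas s hs).measurable.mul h1).div h2).sub measurable_const).stronglyMeasurable
  have hXb : ∀ s ∈ Finset.Icc 1 t, ∀ᵐ ω ∂μ, |X s ω| ≤ t * B := by
    intro s hs
    have h1 := one_div_ite_le hs hτ' hD0 hγt (hγmono s hs t htmem (Finset.mem_Icc.1 hs).2)
    filter_upwards [ae_abs_inverseWeighted_sub_le (A := O s) (hc s hs) (hc1 s hs) (hcq s hs)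
      (hRrange s hs) hμ₀] with ω h
    exact h.2.trans h1
  have hmean : ∀ s ∈ Finset.Icc 1 t, μ[X s | F (s - 1)] =ᵐ[μ] 0 := fun s hs =>
    condExp_inverseWeighted_sub_eq_zero (hc s hs) (hOm s hs) (hqcond s hs) (hqmeas s hs)
      (hcq s hs) (hRm s hs) (hRrange s hs) (hRmean s hs) (hRindep s hs)
  have hvar : ∀ s ∈ Finset.Icc 1 t,
      μ[fun ω => X s ω ^ 2 | F (s - 1)] ≤ᵐ[μ] fun _ => 1 / c s := fun s hs =>
    condExp_sq_inverseWeighted_sub_le (F.le (s - 1)) (hc s hs) (hc1 s hs) (hOm s hs)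
      (hqmeas s hs) (hcq s hs) (hRm s hs) (hRrange s hs) hμ₀ (hmean s hs)
  have hvV : ∑ s ∈ Finset.Icc 1 t, 1 / c s ≤ (t : ℝ) ^ 2 * A :=
    sum_one_div_ite_le ht hτ' hD0 hγpos hγmono
  have hV : 0 < (t : ℝ) ^ 2 * A :=
    (Finset.sum_pos (fun s hs => one_div_pos.2 (hc s hs)) ⟨t, htmem⟩).trans_le hvV
  have hA : 0 < A := pos_of_mul_pos_right hV (sq_nonneg _)
  have htδ : 1 / δ ≤ t / δ := by
    gcongr
    exact_mod_cast ht
  have hL : 0 ≤ L := Real.log_nonneg ((one_le_one_div hδ0 hδ1.le).trans htδ)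
  have hLδ : Real.exp (-L) ≤ δ := by
    rw [Real.exp_neg, hLdef, Real.exp_log (by positivity), inv_div]
    exact div_le_self hδ0.le (by exact_mod_cast ht)
  have hrad : 4 * ((t : ℝ) ^ 2 * A) * L + 5 * (t * B) ^ 2 * L ^ 2 ≤ (t * rad) ^ 2 := by
    rw [mul_pow _ rad, hraddef, Real.sq_sqrt (by positivity)]
    exact le_of_eq (by ring)
  have hupper := measureReal_sum_ge_le_exp_neg (by positivity) hV hL (by positivity) hrad hvV hX hXb
    hmean hvar
  have hlower := measureReal_sum_ge_le_exp_neg (X := fun s ω => -X s ω) (by positivity) hV hL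
    (by positivity) hrad hvV (fun s hs => (hX s hs).neg)
    (fun s hs => by simpa only [abs_neg] using hXb s hs)
    (fun s hs => by
      filter_upwards [condExp_neg (X s) (F (s - 1)) (μ := μ), hmean s hs] with ω h1 h2
      exact h1.trans (by simp [h2]))
    (fun s hs => by simpa only [neg_sq] using hvar s hs)
  have hcover : (Set.univ : Set Ω) ⊆ {ω | |(1 / (t : ℝ)) * ∑ s ∈ Finset.Icc 1 t,
            R s ω * (O s).indicator (fun _ => (1 : ℝ)) ω / q s ω - μ₀| ≤ rad} ∪
      ({ω | t * rad ≤ ∑ s ∈ Finset.Icc 1 t, X s ω} ∪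
        {ω | t * rad ≤ ∑ s ∈ Finset.Icc 1 t, -X s ω}) := by
    intro ω _
    have hsum : (1 / (t : ℝ)) * ∑ s ∈ Finset.Icc 1 t,
        R s ω * (O s).indicator (fun _ => (1 : ℝ)) ω / q s ω - μ₀
        = (∑ s ∈ Finset.Icc 1 t, X s ω) / t := by
      simp only [hXdef, Finset.sum_sub_distrib, Finset.sum_const, Nat.card_Icc, nsmul_eq_mul,
        Nat.add_sub_cancel]
      field_simp
    simp only [Set.mem_union, Set.mem_ofPred_eq, hsum, Finset.sum_neg_distrib, abs_div,
      abs_of_pos htR, div_le_iff₀' htR]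
    rcases le_total (|∑ s ∈ Finset.Icc 1 t, X s ω|) (t * rad) with h | h
    · exact .inl h
    · exact .inr (le_abs.1 h)
  rw [ENNReal.ofReal_le_iff_le_toReal (measure_ne_top _ _), ← measureReal_def]
  have h1 := (measureReal_mono (μ := μ) hcover).trans (measureReal_union_le _ _)
  have h2 := measureReal_union_le (μ := μ) {ω | t * rad ≤ ∑ s ∈ Finset.Icc 1 t, X s ω}
    {ω | t * rad ≤ ∑ s ∈ Finset.Icc 1 t, -X s ω}
  rw [probReal_univ] at h1
  linarith
end

section
/- Let (F_s)_{s=0}^T be a filtration and for each s = 1,...,T let Z_s ∈ {0,1} be an F_s-measurable random variable with P(Z_s = 1 | F_{s-1}) ≤ p̄_s almost surely, where p̄_1, ..., p̄_T ∈ [0,1] are deterministic. Then for every δ ∈ (0,1), with probability at least 1 − δ, Σ_{s=1}^T Z_s ≤ Σ_{s=1}^T p̄_s + sqrt( 4 (Σ_{s=1}^T p̄_s) log(T/δ) + 5 log²(T/δ) ). -/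
open MeasureTheory Finset

/-- If an event has conditional probability at most `p` given `m'`, then its conditional moment
generating factor `exp (l * Z)` inflates the mean of a nonnegative `m'`-measurable `M` by at most
`exp ((exp l - 1) * p)`. -/
lemma integral_mul_exp_le_of_condExp_indicator_le {Ω : Type*} {m' m : MeasurableSpace Ω}
    {μ : Measure Ω} [IsProbabilityMeasure μ] (hm : m' ≤ m) {M Z : Ω → ℝ}
    (hM : StronglyMeasurable[m'] M) (hMint : Integrable M μ) (hM0 : ∀ ω, 0 ≤ M ω)
    (hZ : StronglyMeasurable Z) (hZval : ∀ ω, Z ω = 0 ∨ Z ω = 1) {p l : ℝ} (hl : 0 ≤ l)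
    (hcond : ∀ᵐ ω ∂μ, (μ[({ω' | Z ω' = 1}).indicator (fun _ => (1 : ℝ)) | m']) ω ≤ p) :
    Integrable (fun ω => M ω * Real.exp (l * Z ω)) μ ∧
      ∫ ω, M ω * Real.exp (l * Z ω) ∂μ ≤ (∫ ω, M ω ∂μ) * Real.exp ((Real.exp l - 1) * p) := by
  have hind : ({ω' | Z ω' = 1}).indicator (fun _ => (1 : ℝ)) = Z := by
    funext ω
    rcases hZval ω with h | h <;> simp [Set.indicator, h]
  rw [hind] at hcond
  have hbound : ∀ᵐ ω ∂μ, ‖Z ω‖ ≤ 1 := by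
    refine .of_forall fun ω => ?_
    rcases hZval ω with h | h <;> simp [h]
  have hZint : Integrable Z μ := Integrable.of_bound hZ.aestronglyMeasurable 1 hbound
  have hMZ : Integrable (M * Z) μ := hMint.mul_bdd hZ.aestronglyMeasurable hbound
  have hsplit : (fun ω => M ω * Real.exp (l * Z ω)) =
      fun ω => M ω + (Real.exp l - 1) * (M * Z) ω := by
    funext ω
    rcases hZval ω with h | h <;> simp [h]
    ring
  have hcross : ∫ ω, (M * Z) ω ∂μ ≤ (∫ ω, M ω ∂μ) * p := by
    rw [← integral_condExp hm, ← integral_mul_const]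
    refine integral_mono_ae integrable_condExp (hMint.mul_const p) ?_
    filter_upwards [condExp_mul_of_stronglyMeasurable_left hM hMZ hZint, hcond] with ω h1 h2
    rw [h1]
    exact mul_le_mul_of_nonneg_left h2 (hM0 ω)
  have hexp : 0 ≤ Real.exp l - 1 := sub_nonneg.2 (Real.one_le_exp hl)
  rw [hsplit]
  refine ⟨hMint.add (hMZ.const_mul _), ?_⟩
  rw [integral_add hMint (hMZ.const_mul _), integral_const_mul]
  have h1 := mul_le_mul_of_nonneg_left hcross hexp
  have h2 := mul_le_mul_of_nonneg_left (Real.add_one_le_exp ((Real.exp l - 1) * p))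
    (integral_nonneg hM0 : 0 ≤ ∫ ω, M ω ∂μ)
  linarith

/-- The moment generating function of a sum of adapted indicators with conditional probabilities
at most `pbar s` is dominated by that of a Poisson variable with mean `∑ pbar s`. -/
lemma integral_exp_sum_le_of_condExp_indicator_le {Ω : Type*} {m : MeasurableSpace Ω}
    {μ : Measure Ω} [IsProbabilityMeasure μ] (T : ℕ) (F : Filtration ℕ m) (Z : ℕ → Ω → ℝ)
    (hZval : ∀ s ∈ Finset.Icc 1 T, ∀ ω, Z s ω = 0 ∨ Z s ω = 1)
    (hZmeas : ∀ s ∈ Finset.Icc 1 T, StronglyMeasurable[F s] (Z s)) (pbar : ℕ → ℝ)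
    (hcond : ∀ s ∈ Finset.Icc 1 T, ∀ᵐ ω ∂μ,
      (μ[({ω' | Z s ω' = 1}).indicator (fun _ => (1 : ℝ)) | F (s - 1)]) ω ≤ pbar s)
    {l : ℝ} (hl : 0 ≤ l) (n : ℕ) (hn : n ≤ T) :
    Integrable (fun ω => Real.exp (l * ∑ s ∈ Finset.Icc 1 n, Z s ω)) μ ∧
      ∫ ω, Real.exp (l * ∑ s ∈ Finset.Icc 1 n, Z s ω) ∂μ ≤
        Real.exp ((Real.exp l - 1) * ∑ s ∈ Finset.Icc 1 n, pbar s) := by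
  induction n with
  | zero => simp
  | succ n ih =>
    obtain ⟨hint, hle⟩ := ih (by omega)
    have hmem : n + 1 ∈ Finset.Icc 1 T := Finset.mem_Icc.2 ⟨by omega, hn⟩
    have hsum : StronglyMeasurable[F n] fun ω => ∑ s ∈ Finset.Icc 1 n, Z s ω := by
      refine Finset.stronglyMeasurable_fun_sum _ fun s hs => ?_
      rw [Finset.mem_Icc] at hs
      exact (hZmeas s (Finset.mem_Icc.2 ⟨hs.1, by omega⟩)).mono (F.mono hs.2)
    have hM : StronglyMeasurable[F n] fun ω => Real.exp (l * ∑ s ∈ Finset.Icc 1 n, Z s ω) :=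
      Real.continuous_exp.comp_stronglyMeasurable (hsum.const_mul l)
    obtain ⟨h1, h2⟩ := integral_mul_exp_le_of_condExp_indicator_le (F.le n) hM hint
      (fun ω => (Real.exp_pos _).le) ((hZmeas _ hmem).mono (F.le _)) (hZval _ hmem) hl
      (hcond _ hmem)
    simp only [Finset.sum_Icc_succ_top (Nat.le_add_left 1 n), mul_add, Real.exp_add]
    exact ⟨h1, h2.trans (mul_le_mul_of_nonneg_right hle (Real.exp_pos _).le)⟩

/-- An admissible exponent in the Chernoff bound at deviation `√(4 P L + 5 L²)`. -/
lemma exists_chernoff_exponent {P L : ℝ} (hP : 0 ≤ P) (hL : 0 < L) :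
    ∃ l : ℝ, 0 ≤ l ∧
      L ≤ l * (P + Real.sqrt (4 * P * L + 5 * L ^ 2)) - (Real.exp l - 1) * P := by
  set t := Real.sqrt (4 * P * L + 5 * L ^ 2) with ht
  have hPL : 0 ≤ P * L := by positivity
  have hsq : t ^ 2 = 4 * P * L + 5 * L ^ 2 := Real.sq_sqrt (by positivity)
  have ht0 : 0 < t := Real.sqrt_pos.2 (by positivity)
  have hexp : ∀ l : ℝ, 0 ≤ l → l ≤ 1 → (Real.exp l - 1 - l) * P ≤ l ^ 2 * P := fun l h0 h1 =>
    mul_le_mul_of_nonneg_right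
      ((le_abs_self _).trans (Real.abs_exp_sub_one_sub_id_le (by rwa [abs_of_nonneg h0]))) hP
  rcases le_or_gt t (2 * P) with h | h
  · have hP0 : 0 < P := by linarith
    refine ⟨t / (2 * P), by positivity, ?_⟩
    have h1 := hexp (t / (2 * P)) (by positivity) ((div_le_one (by positivity)).2 h)
    have h2 : t / (2 * P) * t - (t / (2 * P)) ^ 2 * P = t ^ 2 / (4 * P) := by
      field_simp
      ring
    have h3 : L ≤ t ^ 2 / (4 * P) := by
      rw [le_div_iff₀ (by positivity), hsq]
      nlinarith
    linarith
  · refine ⟨1, zero_le_one, ?_⟩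
    have h1 := hexp 1 zero_le_one le_rfl
    have h2 : 2 * L ≤ t := Real.le_sqrt_of_sq_le (by nlinarith)
    linarith

/-- Freedman-type bound on the number of selections: if `Z_s ∈ {0,1}` with
`P(Z_s = 1 | F_{s-1}) ≤ pbar_s` a.s., then with probability at least `1 - δ`,
`∑ Z_s ≤ ∑ pbar_s + sqrt(4 (∑ pbar_s) log(T/δ) + 5 log²(T/δ))`. -/
theorem stmt_4 {Ω : Type*} {m : MeasurableSpace Ω} {μ : Measure Ω}
    [IsProbabilityMeasure μ] (T : ℕ) (F : Filtration ℕ m)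
    (Z : ℕ → Ω → ℝ)
    (hZval : ∀ s ∈ Finset.Icc 1 T, ∀ ω, Z s ω = 0 ∨ Z s ω = 1)
    (hZmeas : ∀ s ∈ Finset.Icc 1 T, StronglyMeasurable[F s] (Z s))
    (pbar : ℕ → ℝ) (hpbar : ∀ s ∈ Finset.Icc 1 T, pbar s ∈ Set.Icc (0 : ℝ) 1)
    (hcond : ∀ s ∈ Finset.Icc 1 T, ∀ᵐ ω ∂μ,
      (μ[({ω' | Z s ω' = 1}).indicator (fun _ => (1 : ℝ)) | F (s - 1)]) ω ≤ pbar s)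
    (δ : ℝ) (hδ0 : 0 < δ) (hδ1 : δ < 1) :
    ENNReal.ofReal (1 - δ) ≤
      μ {ω | ∑ s ∈ Finset.Icc 1 T, Z s ω ≤ ∑ s ∈ Finset.Icc 1 T, pbar s +
        Real.sqrt (4 * (∑ s ∈ Finset.Icc 1 T, pbar s) * Real.log ((T : ℝ) / δ)
          + 5 * Real.log ((T : ℝ) / δ) ^ 2)} := by
  rcases Nat.eq_zero_or_pos T with rfl | hT
  · simp [hδ0.le]
  have hT1 : (1 : ℝ) ≤ T := by exact_mod_cast hT
  have hL : 0 < Real.log ((T : ℝ) / δ) :=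
    Real.log_pos ((one_lt_div hδ0).2 (hδ1.trans_le hT1))
  have hP : 0 ≤ ∑ s ∈ Finset.Icc 1 T, pbar s := Finset.sum_nonneg fun s hs => (hpbar s hs).1
  obtain ⟨l, hl, hlL⟩ := exists_chernoff_exponent hP hL
  obtain ⟨hint, hmgf⟩ :=
    integral_exp_sum_le_of_condExp_indicator_le T F Z hZval hZmeas pbar hcond hl T le_rfl
  set P := ∑ s ∈ Finset.Icc 1 T, pbar s
  set L := Real.log ((T : ℝ) / δ) with hLdef
  set b := P + Real.sqrt (4 * P * L + 5 * L ^ 2)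
  have hmeas : Measurable fun ω => ∑ s ∈ Finset.Icc 1 T, Z s ω :=
    Finset.measurable_fun_sum _ fun s hs => ((hZmeas s hs).mono (F.le s)).measurable
  have hexpL : Real.exp (-L) ≤ δ := by
    rw [Real.exp_neg, hLdef, Real.exp_log (by positivity), inv_div]
    exact div_le_self hδ0.le hT1
  have htail : μ.real {ω | b ≤ ∑ s ∈ Finset.Icc 1 T, Z s ω} ≤ δ := by
    refine (ProbabilityTheory.measure_ge_le_exp_mul_mgf b hl hint).trans ?_
    refine (mul_le_mul_of_nonneg_left hmgf (Real.exp_pos _).le).trans ?_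
    rw [← Real.exp_add]
    exact (Real.exp_le_exp.2 (by linarith)).trans hexpL
  have hcompl : {ω | ∑ s ∈ Finset.Icc 1 T, Z s ω ≤ b}ᶜ ⊆
      {ω | b ≤ ∑ s ∈ Finset.Icc 1 T, Z s ω} := fun ω hω =>
    (lt_of_not_ge (by simpa using hω)).le
  have hbad := (measureReal_mono hcompl (measure_ne_top μ _)).trans htail
  rw [probReal_compl_eq_one_sub (measurableSet_le hmeas measurable_const)] at hbad
  rw [ENNReal.ofReal_le_iff_le_toReal (measure_ne_top μ _)]
  change 1 - δ ≤ μ.real _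
  linarith
end

section
/- Let V be a finite set, A ⊆ V a nonempty subset, and H, H̃ : V → ℝ, R : V → [0, ∞) functions with |H̃(k) − H(k)| ≤ R(k) for all k ∈ V. Let I* ∈ A be a maximizer of H over A and j ∈ A a maximizer of H̃ over A, and suppose R(I*) = R(j). If for every i ∈ V \ A it holds that H̃(j) − H̃(i) > 3 R(j) + R(i), then H(I*) > H(i) for every i ∈ V \ A; consequently, every maximizer of H over all of V lies in A. -/
/-- In the adversarial setting, the arm with the largest cumulative reward is
never deleted: on the event where every estimate `Ht k` is within `R k` of the
(scaled) cumulative reward `H k`, if no deleted arm triggers the detection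
condition, then every deleted arm is strictly worse than the best active arm
`Istar`; consequently every maximizer of `H` over all of `V` lies in `A`. -/
theorem stmt_8 {V : Type*} [Fintype V] [DecidableEq V] (A : Finset V)
    (hA : A.Nonempty) (H Ht : V → ℝ) (R : V → ℝ) (hR : ∀ k, 0 ≤ R k)
    (hcon : ∀ k, |Ht k - H k| ≤ R k)
    (Istar : V) (hIstarA : Istar ∈ A) (hIstarmax : ∀ k ∈ A, H k ≤ H Istar)
    (j : V) (hjA : j ∈ A) (hjmax : ∀ k ∈ A, Ht k ≤ Ht j)
    (hReq : R Istar = R j)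
    (hdet : ∀ i, i ∉ A → Ht j - Ht i > 3 * R j + R i) :
    (∀ i, i ∉ A → H i < H Istar) ∧
      (∀ v : V, (∀ k, H k ≤ H v) → v ∈ A) := by
  have deleted_lt : ∀ i, i ∉ A → H i < H Istar := by
    intro i hi
    have hi' := (abs_le.mp (hcon i)).1
    have hj := (abs_le.mp (hcon j)).2
    linarith [hdet i hi, hR j, hIstarmax j hjA]
  refine ⟨deleted_lt, fun v hv => ?_⟩
  by_contra hvA
  exact (deleted_lt v hvA).not_ge (hv Istar)
end

section
/- Let K, D, t be positive integers, let Δ ∈ (0,1] and L ≥ 1 be real numbers, and set γ_s = K^{2/3} D^{1/3} s^{−1/3} for each positive integer s. If Δ ≤ 10 · sqrt( (4D/t²) · (Σ_{s=1}^{t} 1/γ_s) · L + (5 D² / (γ_t² t²)) · L² ), then t ≤ 10^5 · (D/K) · (L/Δ²)^{3/2}. -/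
open Finset

/-- Every positive real is the cube of a positive real, its cube root, and the real powers with
exponents `1 / 3`, `2 / 3` and `-1 / 3` are monomials in that root. -/
lemma exists_pos_cube_root {x : ℝ} (hx : 0 < x) :
    ∃ a : ℝ, 0 < a ∧ x = a ^ 3 ∧ x ^ ((1 : ℝ) / 3) = a ∧ x ^ ((2 : ℝ) / 3) = a ^ 2 ∧
      x ^ (-(1 : ℝ) / 3) = a⁻¹ := by
  refine ⟨x ^ ((1 : ℝ) / 3), by positivity, ?_, rfl, ?_, ?_⟩
  · rw [← Real.rpow_natCast, ← Real.rpow_mul hx.le]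
    norm_num
  · rw [← Real.rpow_natCast, ← Real.rpow_mul hx.le]
    norm_num
  · rw [← Real.rpow_neg hx.le]
    norm_num

/-- Inversion step bounding the elimination time of a suboptimal arm with gap
`Δ`: if `Δ` is at most `10` times the confidence radius at time `t` under the
exploration schedule `γ_s = K^{2/3} D^{1/3} s^{-1/3}`, then
`t ≤ 10^5 (D/K) (L/Δ²)^{3/2}`. -/
theorem stmt_11 (K D t : ℕ) (hK : 0 < K) (hD : 0 < D) (ht : 0 < t)
    (Δ L : ℝ) (hΔ0 : 0 < Δ) (hΔ1 : Δ ≤ 1) (hL : 1 ≤ L)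
    (γ : ℕ → ℝ)
    (hγ : ∀ s : ℕ, 0 < s →
      γ s = (K : ℝ) ^ ((2 : ℝ) / 3) * (D : ℝ) ^ ((1 : ℝ) / 3)
        * (s : ℝ) ^ (-(1 : ℝ) / 3))
    (h : Δ ≤ 10 * Real.sqrt ((4 * (D : ℝ) / (t : ℝ) ^ 2)
        * (∑ s ∈ Finset.Icc 1 t, 1 / γ s) * L
      + (5 * (D : ℝ) ^ 2 / (γ t ^ 2 * (t : ℝ) ^ 2)) * L ^ 2)) :
    (t : ℝ) ≤ 10 ^ 5 * ((D : ℝ) / (K : ℝ)) * (L / Δ ^ 2) ^ ((3 : ℝ) / 2) := by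
  have hKr : (0 : ℝ) < K := by exact_mod_cast hK
  have hDr : (0 : ℝ) < D := by exact_mod_cast hD
  have htr : (0 : ℝ) < t := by exact_mod_cast ht
  have hL0 : 0 < L := by linarith
  obtain ⟨a, ha, hKa, -, hKa2, -⟩ := exists_pos_cube_root hKr
  obtain ⟨d, hd, hDd, hDd1, -, -⟩ := exists_pos_cube_root hDr
  obtain ⟨u, hu, htu, htu1, -, htu3⟩ := exists_pos_cube_root htr
  have hγt : γ t = a ^ 2 * d * u⁻¹ := by rw [hγ t ht, hKa2, hDd1, htu3]
  have hsum : ∑ s ∈ Finset.Icc 1 t, 1 / γ s ≤ u ^ 4 / (a ^ 2 * d) := by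
    calc ∑ s ∈ Finset.Icc 1 t, 1 / γ s
        ≤ ∑ _s ∈ Finset.Icc 1 t, u / (a ^ 2 * d) := by
          refine Finset.sum_le_sum fun s hs => ?_
          obtain ⟨hs1, hst⟩ := Finset.mem_Icc.mp hs
          have hsr : (0 : ℝ) < s := by exact_mod_cast hs1
          obtain ⟨w, hw, -, hw1, -, hw3⟩ := exists_pos_cube_root hsr
          have hwu : w ≤ u := by
            rw [← hw1, ← htu1]
            exact Real.rpow_le_rpow hsr.le (by exact_mod_cast hst) (by norm_num)
          have hγs : 1 / γ s = w / (a ^ 2 * d) := by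
            rw [hγ s hs1, hKa2, hDd1, hw3]
            field_simp
          rw [hγs]
          gcongr
      _ = u ^ 4 / (a ^ 2 * d) := by
          rw [Finset.sum_const, Nat.card_Icc, nsmul_eq_mul, Nat.add_sub_cancel, htu]
          ring
  -- `x` is, up to constants, the first term of the squared radius, and `x ^ 2` the second one.
  set x : ℝ := d ^ 2 * L / (a ^ 2 * u ^ 2) with hx
  have hx0 : 0 < x := by positivity
  have hrad : (4 * (D : ℝ) / (t : ℝ) ^ 2) * (∑ s ∈ Finset.Icc 1 t, 1 / γ s) * L
      + (5 * (D : ℝ) ^ 2 / (γ t ^ 2 * (t : ℝ) ^ 2)) * L ^ 2 ≤ 4 * x + 5 * x ^ 2 := by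
    calc _ ≤ (4 * (D : ℝ) / (t : ℝ) ^ 2) * (u ^ 4 / (a ^ 2 * d)) * L
          + (5 * (D : ℝ) ^ 2 / (γ t ^ 2 * (t : ℝ) ^ 2)) * L ^ 2 := by gcongr
      _ = 4 * x + 5 * x ^ 2 := by
          rw [hγt, hDd, htu, hx]
          field_simp
  have hsq : Δ ^ 2 ≤ 100 * (4 * x + 5 * x ^ 2) := by
    have h' : Δ ≤ 10 * √(4 * x + 5 * x ^ 2) := h.trans (by gcongr)
    calc Δ ^ 2 ≤ (10 * √(4 * x + 5 * x ^ 2)) ^ 2 := by gcongr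
      _ = 100 * (4 * x + 5 * x ^ 2) := by
          rw [mul_pow, Real.sq_sqrt (by positivity)]
          norm_num
  have hΔx : Δ ^ 2 ≤ 46 ^ 2 * x := by
    rcases le_total x 1 with hx1 | hx1 <;> nlinarith
  obtain ⟨v, hv⟩ : ∃ v, v = √(L / Δ ^ 2) := ⟨_, rfl⟩
  have hv0 : 0 < v := by rw [hv]; positivity
  have hv2 : v ^ 2 = L / Δ ^ 2 := by rw [hv, Real.sq_sqrt (by positivity)]
  have hv3 : (L / Δ ^ 2) ^ ((3 : ℝ) / 2) = v ^ 3 := by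
    rw [← hv2, ← Real.rpow_natCast v 2, ← Real.rpow_mul hv0.le, ← Real.rpow_natCast v 3]
    norm_num
  have huv : u ≤ 46 * (d / a) * v := by
    refine (sq_le_sq₀ hu.le (by positivity)).mp ?_
    rw [mul_pow, hv2]
    have hux : 46 ^ 2 * x = (46 * (d / a)) ^ 2 * L / u ^ 2 := by
      rw [hx]
      field_simp
    rw [hux, le_div_iff₀ (by positivity)] at hΔx
    rw [← mul_div_assoc, le_div_iff₀ (by positivity)]
    linarith
  rw [hv3, htu, hDd, hKa]
  calc u ^ 3 ≤ (46 * (d / a) * v) ^ 3 := by gcongr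
    _ = 46 ^ 3 * (d ^ 3 / a ^ 3) * v ^ 3 := by ring
    _ ≤ 10 ^ 5 * (d ^ 3 / a ^ 3) * v ^ 3 := by
      gcongr
      norm_num
end
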